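/- Let α < 1/2 and let {φ_k}_{k=1,…,n} be a *-moment sequence. Then there exist real numbers λ₁, …, λ_n such that for each k = 1, …, n, the function φ_k satisfies L φ_k(x) = Σ_{j=1}^{k} C(k,j) λ_j φ_{k−j}(x) for x > 0 (where φ₀ ≡ 1 and C(k,j) is the binomial coefficient), together with the boundary conditions φ_k(0) = 0 and φ_k′(0) = 0. -/

import Mathlib

open MeasureTheory Measure Set Filter Topology

noncomputable section

/-- The Pochhammer symbol `(a)ₙ`. -/
def poch (a : ℂ) (n : ℕ) : ℂ := ∏ i ∈ Finset.range n, (a + i)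

/-- Kummer's confluent hypergeometric function `M(a,b;z)` (power series). -/
def kummerM (a b z : ℂ) : ℂ := ∑' n : ℕ, poch a n / poch b n * z ^ n / (n.factorial : ℂ)

/-- Tricomi's confluent hypergeometric function `Ψ(a,b;z)`. -/
def tricomiU (a b z : ℂ) : ℂ :=
  Complex.Gamma (1 - b) / Complex.Gamma (a + 1 - b) * kummerM a b z
    + Complex.Gamma (b - 1) / Complex.Gamma a * z ^ ((1 : ℂ) - b) * kummerM (a - b + 1) (2 - b) z

/-- The parabolic cylinder function `D_μ(z)` (real argument). -/
def cylinderD (μ : ℂ) (z : ℝ) : ℂ :=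
  (2 : ℂ) ^ (μ / 2) * Complex.exp (-(z : ℂ) ^ 2 / 4) * tricomiU (-μ / 2) (1 / 2) ((z : ℂ) ^ 2 / 2)

/-- The Whittaker function of the second kind `W_{κ,ν}(z)` (positive real argument). -/
def whittakerW (κ ν : ℂ) (z : ℝ) : ℂ :=
  Complex.exp (-(z : ℂ) / 2) * (z : ℂ) ^ ((1 : ℂ) / 2 + ν) * tricomiU (1 / 2 - κ + ν) (1 + 2 * ν) z

/-- The modified Whittaker-type kernel `𝑾_{α,ν}(x) = 2^α x^{2α} e^{1/(4x²)} W_{α,ν}(1/(2x²))`,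
extended continuously by `𝑾_{α,ν}(0) = 1`. -/
def bW (α ν : ℂ) (x : ℝ) : ℂ :=
  if x = 0 then 1
  else (2 : ℂ) ^ α * (x : ℂ) ^ (2 * α) * Complex.exp (1 / (4 * (x : ℂ) ^ 2)) *
      whittakerW α ν (1 / (2 * x ^ 2))

/-- Real-valued version of `𝑾_{α,ν}(x)` (real `α`; `𝑾` is real for the relevant `ν`). -/
def bWr (α : ℝ) (ν : ℂ) (x : ℝ) : ℝ := (bW α ν x).re

/-- `Δ_λ := √((1/2 − α)² − λ)` (principal square root, so `= i√(λ − (1/2 − α)²)` for large λ). -/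
def Δl (α lam : ℝ) : ℂ := ((((1 / 2 - α) ^ 2 - lam : ℝ) : ℂ)) ^ ((1 : ℂ) / 2)

/-- The weight `m(x) = x^{1−4α} e^{−1/(2x²)}`. -/
def mw (α x : ℝ) : ℝ := x ^ (1 - 4 * α) * Real.exp (-1 / (2 * x ^ 2))

/-- The measure `m(x) dx` on `(0,∞)`. -/
def mMeas (α : ℝ) : Measure ℝ :=
  (volume.restrict (Ioi 0)).withDensity fun x => ENNReal.ofReal (mw α x)

/-- Real-valued parabolic cylinder function. -/
def Dr (μ z : ℝ) : ℝ := (cylinderD μ z).re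

/-- The kernel `q(x,y,ξ)` of the index Whittaker product formula. -/
def qk (α x y ξ : ℝ) : ℝ :=
  (2 * Real.pi) ^ (-(1 : ℝ) / 2) * (x * y * ξ) ^ (-1 + 2 * α) *
    Real.exp (1 / (2 * x ^ 2) + 1 / (2 * y ^ 2) + 1 / (2 * ξ ^ 2)
      - ((x ^ 2 + y ^ 2 + ξ ^ 2) / (4 * x * y * ξ)) ^ 2) *
    Dr (2 * α) ((x ^ 2 + y ^ 2 + ξ ^ 2) / (2 * x * y * ξ))

/-- Index Whittaker transform of a measure. -/
def iwHat (α : ℝ) (μ : Measure ℝ) (lam : ℝ) : ℝ := ∫ x, bWr α (Δl α lam) x ∂μ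

/-- Index Whittaker translation `(T^y f)(x)` for `x, y > 0`. -/
def translPos (α : ℝ) (f : ℝ → ℝ) (y x : ℝ) : ℝ :=
  ∫ ξ in Ioi (0 : ℝ), f ξ * qk α x y ξ * mw α ξ

/-- Index Whittaker translation with the boundary conventions
`(T^x f)(0) = (T^0 f)(x) = f(x)`. -/
def transl (α : ℝ) (f : ℝ → ℝ) (y x : ℝ) : ℝ :=
  if x = 0 then f y else if y = 0 then f x else translPos α f y x

/-- The transition kernel `δ_x * δ_y` of the index Whittaker convolution. -/
def iwKernel (α x y : ℝ) : Measure ℝ :=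
  if x = 0 then Measure.dirac y
  else if y = 0 then Measure.dirac x
  else (volume.restrict (Ioi 0)).withDensity fun ξ => ENNReal.ofReal (qk α x y ξ * mw α ξ)

/-- The index Whittaker convolution of two measures on `[0,∞)`. -/
def iwConv (α : ℝ) (μ ν : Measure ℝ) : Measure ℝ :=
  (μ.prod ν).bind fun p => iwKernel α p.1 p.2

/-- `n`-fold index Whittaker convolution power. -/
def iwConvPow (α : ℝ) (μ : Measure ℝ) : ℕ → Measure ℝ
  | 0 => Measure.dirac 0
  | n + 1 => iwConv α (iwConvPow α μ n) μ

/-- A measure on `ℝ` is supported on the half-line `[0,∞)`. -/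
def OnHalfLine (μ : Measure ℝ) : Prop := μ {x | x < 0} = 0

/-- `*`-infinite divisibility with respect to the index Whittaker convolution. -/
def IsIWInfDiv (α : ℝ) (μ : Measure ℝ) : Prop :=
  IsProbabilityMeasure μ ∧ OnHalfLine μ ∧
    ∀ n : ℕ, 0 < n → ∃ ν : Measure ℝ,
      IsProbabilityMeasure ν ∧ OnHalfLine ν ∧ μ = iwConvPow α ν n

/-- The `*`-compound Poisson measure `e(aμ)`. -/
def iwCompoundPoisson (α a : ℝ) (μ : Measure ℝ) : Measure ℝ :=
  Measure.sum fun k : ℕ =>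
    (ENNReal.ofReal (Real.exp (-a) * a ^ k / k.factorial)) • iwConvPow α μ k

/-- `*`-Gaussian measures. -/
def IsIWGaussian (α : ℝ) (μ : Measure ℝ) : Prop :=
  IsIWInfDiv α μ ∧
    ∀ a : ℝ, 0 < a → ∀ ν ϑ : Measure ℝ, IsProbabilityMeasure ν → OnHalfLine ν →
      IsIWInfDiv α ϑ → μ = iwConv α (iwCompoundPoisson α a ν) ϑ → ν = Measure.dirac 0

/-- `*`-convolution semigroups. -/
structure IsIWConvSemigroup (α : ℝ) (μ : ℝ → Measure ℝ) : Prop where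
  prob : ∀ t, 0 ≤ t → IsProbabilityMeasure (μ t)
  half : ∀ t, 0 ≤ t → OnHalfLine (μ t)
  conv : ∀ s t, 0 ≤ s → 0 ≤ t → μ (s + t) = iwConv α (μ s) (μ t)
  zero : μ 0 = Measure.dirac 0
  cont : ∀ f : BoundedContinuousFunction ℝ ℝ,
    Tendsto (fun t => ∫ x, f x ∂(μ t)) (𝓝[>] (0 : ℝ)) (𝓝 (f 0))


/-- The class `E` of measurable functions on `(0,∞)` with
`|f(x)| ≤ b₁ exp(1/(2x²) + b₂(x^{−β} + x^{β}))`, `0 ≤ β < 2`. -/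
def InE (f : ℝ → ℝ) : Prop :=
  Measurable f ∧ ∃ b₁ b₂ β : ℝ, 0 ≤ b₁ ∧ 0 ≤ b₂ ∧ 0 ≤ β ∧ β < 2 ∧
    ∀ x : ℝ, 0 < x → |f x| ≤ b₁ * Real.exp (1 / (2 * x ^ 2) + b₂ * (x ^ (-β) + x ^ β))

/-- The differential operator `L = −(1/4)[x² d²/dx² + (x⁻¹ + (3 − 4α)x) d/dx]`. -/
def Lop (α : ℝ) (f : ℝ → ℝ) (x : ℝ) : ℝ :=
  -(1 / 4) * (x ^ 2 * deriv (deriv f) x + (x⁻¹ + (3 - 4 * α) * x) * deriv f x)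

/-- `φ` (with `φ 0 ≡ 1`) is a `*`-moment sequence of length `n`. -/
def IsMomentSequence (α : ℝ) (n : ℕ) (φ : ℕ → ℝ → ℝ) : Prop :=
  (∀ x : ℝ, φ 0 x = 1) ∧
  (∀ k, 1 ≤ k → k ≤ n → InE (φ k)) ∧
  (∀ k, 1 ≤ k → k ≤ n → ∀ x y : ℝ, 0 ≤ x → 0 ≤ y →
    transl α (φ k) y x =
      ∑ j ∈ Finset.range (k + 1), (k.choose j : ℝ) * φ j x * φ (k - j) y)

/-- The integral `∫₀^∞ t^{μ-1} e^{-zt-t²/2} dt`, a multiple of `e^{z²/4} D_{-μ}(z)`. -/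
def cylInt (μ z : ℝ) : ℝ := ∫ t in Ioi (0 : ℝ), t ^ (μ - 1) * Real.exp (-z * t - t ^ 2 / 2)

/-- The moments `∫₀^∞ t^{s-1} e^{-t²/2} dt` of the Gaussian, in closed form. -/
def gaussMoment (s : ℝ) : ℝ := 2 ^ (s / 2 - 1) * Real.Gamma (s / 2)

lemma integrableOn_rpow_mul_exp_neg_sq {μ : ℝ} (hμ : 0 < μ) (z : ℝ) :
    IntegrableOn (fun t : ℝ => t ^ (μ - 1) * Real.exp (-z * t - t ^ 2 / 2)) (Ioi 0) := by
  have h := (integrableOn_rpow_mul_exp_neg_mul_sq (b := 1 / 4) (by norm_num)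
    (s := μ - 1) (by linarith)).const_mul (Real.exp (z ^ 2))
  refine Integrable.mono' h (by fun_prop) ?_
  filter_upwards [ae_restrict_mem measurableSet_Ioi] with t ht
  have ht' : (0 : ℝ) < t := ht
  have hp : 0 < t ^ (μ - 1) := Real.rpow_pos_of_pos ht' _
  rw [Real.norm_of_nonneg (by positivity)]
  have : Real.exp (-z * t - t ^ 2 / 2) ≤ Real.exp (z ^ 2) * Real.exp (-(1 / 4) * t ^ 2) := by
    rw [← Real.exp_add]
    exact Real.exp_le_exp.2 (by nlinarith [sq_nonneg (t / 2 + z)])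
  calc _ ≤ t ^ (μ - 1) * (Real.exp (z ^ 2) * Real.exp (-(1 / 4) * t ^ 2)) := by gcongr
    _ = _ := by ring

lemma cylInt_nonneg (μ z : ℝ) : 0 ≤ cylInt μ z :=
  setIntegral_nonneg measurableSet_Ioi fun t ht => by
    have ht' : (0 : ℝ) < t := ht
    positivity

lemma cylInt_le_zero {μ z : ℝ} (hμ : 0 < μ) (hz : 0 ≤ z) : cylInt μ z ≤ cylInt μ 0 := by
  refine setIntegral_mono_on (integrableOn_rpow_mul_exp_neg_sq hμ z)
    (integrableOn_rpow_mul_exp_neg_sq hμ 0) measurableSet_Ioi fun t ht => ?_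
  have ht' : (0 : ℝ) < t := ht
  gcongr

lemma hasDerivAt_cylInt {μ z : ℝ} (hμ : 0 < μ) (hz : 0 < z) :
    HasDerivAt (cylInt μ) (-cylInt (μ + 1) z) z := by
  have key := hasDerivAt_integral_of_dominated_loc_of_deriv_le
    (μ := volume.restrict (Ioi (0 : ℝ))) (𝕜 := ℝ) (x₀ := z) (s := Ioi 0)
    (F := fun z t => t ^ (μ - 1) * Real.exp (-z * t - t ^ 2 / 2))
    (F' := fun z t => -(t ^ (μ + 1 - 1) * Real.exp (-z * t - t ^ 2 / 2)))
    (bound := fun t => t ^ (μ + 1 - 1) * Real.exp (-0 * t - t ^ 2 / 2))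
    (Ioi_mem_nhds hz) (.of_forall fun y => by fun_prop)
    (integrableOn_rpow_mul_exp_neg_sq hμ z) (by fun_prop) ?_
    (integrableOn_rpow_mul_exp_neg_sq (by linarith) 0) ?_
  · have := key.2
    rw [integral_neg] at this
    exact this
  · filter_upwards [ae_restrict_mem measurableSet_Ioi] with t ht y hy
    have ht' : (0 : ℝ) < t := ht
    have hy' : (0 : ℝ) < y := hy
    rw [norm_neg, Real.norm_of_nonneg (by positivity)]
    gcongr
  · filter_upwards [ae_restrict_mem measurableSet_Ioi] with t ht y hy
    have ht' : (0 : ℝ) < t := ht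
    have h1 : HasDerivAt (fun z : ℝ => -z * t - t ^ 2 / 2) (-t) y := by
      simpa using (((hasDerivAt_id y).neg.mul_const t).sub_const (t ^ 2 / 2))
    have h2 := (h1.exp).const_mul (t ^ (μ - 1))
    refine h2.congr_deriv ?_
    rw [add_sub_cancel_right, Real.rpow_sub_one ht'.ne']
    field_simp

lemma cylInt_add_two {μ : ℝ} (hμ : 0 < μ) (z : ℝ) :
    cylInt (μ + 2) z + z * cylInt (μ + 1) z = μ * cylInt μ z := by
  have i0 := integrableOn_rpow_mul_exp_neg_sq hμ z
  have i1 := integrableOn_rpow_mul_exp_neg_sq (μ := μ + 1) (by linarith) z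
  have i2 := integrableOn_rpow_mul_exp_neg_sq (μ := μ + 2) (by linarith) z
  have key := integral_Ioi_of_hasDerivAt_of_tendsto (a := (0 : ℝ)) (m := 0)
    (f := fun t : ℝ => t ^ μ * Real.exp (-z * t - t ^ 2 / 2))
    (f' := fun t : ℝ => μ * (t ^ (μ - 1) * Real.exp (-z * t - t ^ 2 / 2))
      - z * (t ^ (μ + 1 - 1) * Real.exp (-z * t - t ^ 2 / 2))
      - t ^ (μ + 2 - 1) * Real.exp (-z * t - t ^ 2 / 2)) ?_ ?_
      (((i0.const_mul μ).sub (i1.const_mul z)).sub i2) ?_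
  · have e := integral_sub ((i0.const_mul μ).sub (i1.const_mul z)) i2
    simp only [Pi.sub_apply] at e
    rw [e, integral_sub (i0.const_mul μ) (i1.const_mul z), integral_const_mul, integral_const_mul,
      Real.zero_rpow hμ.ne'] at key
    simp only [cylInt]
    linarith
  · refine ContinuousAt.continuousWithinAt ?_
    exact (Real.continuousAt_rpow_const _ _ (Or.inr hμ.le)).mul (by fun_prop)
  · intro t ht
    have ht' : (0 : ℝ) < t := ht
    have h1 : HasDerivAt (fun t : ℝ => -z * t - t ^ 2 / 2) (-z - t) t := by
      have := (((hasDerivAt_id t).const_mul (-z)).sub ((hasDerivAt_pow 2 t).div_const 2))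
      refine this.congr_deriv ?_
      simp
    refine ((Real.hasDerivAt_rpow_const (p := μ) (Or.inl ht'.ne')).mul h1.exp).congr_deriv ?_
    have e : t ^ μ = t ^ (μ - 1) * t := by rw [← Real.rpow_add_one ht'.ne', sub_add_cancel]
    rw [show μ + 2 - 1 = (μ - 1) + 1 + 1 by ring, show μ + 1 - 1 = (μ - 1) + 1 by ring]
    simp only [Real.rpow_add_one ht'.ne', e]
    ring
  · have h := rpow_mul_exp_neg_mul_sq_isLittleO_exp_neg (b := 1 / 4) (by norm_num) μ
    have h0 : Tendsto (fun x : ℝ => Real.exp (-(1 / 2) * x)) atTop (𝓝 0) := by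
      refine Real.tendsto_exp_atBot.comp ?_
      exact tendsto_id.const_mul_atTop_of_neg (by norm_num)
    have h1 := (h.trans_tendsto h0).const_mul (Real.exp (z ^ 2))
    rw [mul_zero] at h1
    refine squeeze_zero' ?_ ?_ h1
    · filter_upwards [eventually_gt_atTop 0] with t ht
      positivity
    · filter_upwards [eventually_gt_atTop 0] with t ht
      have : Real.exp (-z * t - t ^ 2 / 2) ≤ Real.exp (z ^ 2) * Real.exp (-(1 / 4) * t ^ 2) := by
        rw [← Real.exp_add]
        exact Real.exp_le_exp.2 (by nlinarith [sq_nonneg (t / 2 + z)])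
      calc _ ≤ t ^ μ * (Real.exp (z ^ 2) * Real.exp (-(1 / 4) * t ^ 2)) := by gcongr
        _ = _ := by ring

lemma integral_rpow_mul_exp_neg_sq {s : ℝ} (hs : 0 < s) :
    ∫ t in Ioi (0 : ℝ), t ^ (s - 1) * Real.exp (-t ^ 2 / 2) = gaussMoment s := by
  have h := integral_rpow_mul_exp_neg_mul_rpow (p := 2) (q := s - 1) (b := 1 / 2)
    (by norm_num) (by linarith) (by norm_num)
  have e : ∀ t : ℝ, t ^ (s - 1) * Real.exp (-t ^ 2 / 2)
      = t ^ (s - 1) * Real.exp (-(1 / 2) * t ^ (2 : ℝ)) := fun t => by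
    rw [Real.rpow_two]; congr 2; ring
  simp_rw [e]
  rw [h, gaussMoment, sub_add_cancel, one_div, Real.inv_rpow (by norm_num),
    ← Real.rpow_neg (by norm_num), neg_div, neg_neg, Real.rpow_sub_one (by norm_num)]
  ring

lemma hasSum_cylInt {μ : ℝ} (hμ : 0 < μ) (z : ℝ) :
    HasSum (fun n : ℕ => (-z) ^ n / n.factorial * gaussMoment (n + μ)) (cylInt μ z) := by
  have hexp : ∀ a : ℝ, HasSum (fun n : ℕ => a ^ n / n.factorial) (Real.exp a) := fun a => by
    rw [Real.exp_eq_exp_ℝ]; exact NormedSpace.expSeries_div_hasSum_exp a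
  have key := hasSum_integral_of_dominated_convergence
    (μ := volume.restrict (Ioi (0 : ℝ)))
    (F := fun (n : ℕ) t => t ^ (μ - 1) * Real.exp (-t ^ 2 / 2) * ((-z * t) ^ n / n.factorial))
    (f := fun t => t ^ (μ - 1) * Real.exp (-z * t - t ^ 2 / 2))
    (fun n t => t ^ (μ - 1) * Real.exp (-t ^ 2 / 2) * ((|z| * t) ^ n / n.factorial))
    (fun n => by fun_prop) ?_ ?_ ?_ ?_
  · refine key.congr_fun fun n => ?_
    rw [← integral_rpow_mul_exp_neg_sq (by positivity), ← integral_const_mul]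
    refine setIntegral_congr_fun measurableSet_Ioi fun t ht => ?_
    have ht' : (0 : ℝ) < t := ht
    rw [show (n : ℝ) + μ - 1 = (μ - 1) + n by ring, Real.rpow_add ht', Real.rpow_natCast, mul_pow]
    ring
  · intro n
    filter_upwards [ae_restrict_mem measurableSet_Ioi] with t ht
    have ht' : (0 : ℝ) < t := ht
    have hp : 0 < t ^ (μ - 1) := Real.rpow_pos_of_pos ht' _
    rw [norm_mul, Real.norm_of_nonneg (by positivity), norm_div, norm_pow, norm_mul, norm_neg,
      Real.norm_of_nonneg ht'.le, Real.norm_natCast, Real.norm_eq_abs]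
  · exact .of_forall fun t => (hexp (|z| * t)).summable.mul_left _
  · refine (integrableOn_rpow_mul_exp_neg_sq hμ (-|z|)).congr (.of_forall fun t => ?_)
    simp only
    rw [((hexp (|z| * t)).mul_left _).tsum_eq, mul_assoc, ← Real.exp_add]
    congr 2; ring
  · refine .of_forall fun t => ?_
    have h := (hexp (-z * t)).mul_left (t ^ (μ - 1) * Real.exp (-t ^ 2 / 2))
    rw [mul_assoc, ← Real.exp_add, show -t ^ 2 / 2 + -z * t = -z * t - t ^ 2 / 2 by ring] at h
    exact h

lemma rpow_mul_cylInt {μ z : ℝ} (hz : 0 < z) :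
    z ^ μ * cylInt μ z
      = ∫ s in Ioi (0 : ℝ), s ^ (μ - 1) * Real.exp (-s - (s / z) ^ 2 / 2) := by
  have h := integral_comp_mul_left_Ioi
    (fun t : ℝ => t ^ (μ - 1) * Real.exp (-z * t - t ^ 2 / 2)) 0 (inv_pos.2 hz)
  rw [mul_zero, inv_inv, smul_eq_mul] at h
  change _ = z * cylInt μ z at h
  rw [show z ^ μ * cylInt μ z = z ^ (μ - 1) * (z * cylInt μ z) by
    rw [Real.rpow_sub_one hz.ne']; field_simp, ← h, ← integral_const_mul]
  refine setIntegral_congr_fun measurableSet_Ioi fun s hs => ?_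
  have hs' : (0 : ℝ) < s := hs
  rw [Real.mul_rpow (by positivity) hs'.le, Real.inv_rpow hz.le]
  have : z ^ (μ - 1) ≠ 0 := (Real.rpow_pos_of_pos hz _).ne'
  rw [← mul_assoc, ← mul_assoc, mul_inv_cancel₀ this, one_mul]
  congr 2
  field_simp

lemma tendsto_rpow_mul_cylInt {μ : ℝ} (hμ : 0 < μ) :
    Tendsto (fun z => z ^ μ * cylInt μ z) atTop (𝓝 (Real.Gamma μ)) := by
  have key := tendsto_integral_filter_of_dominated_convergence (l := (atTop : Filter ℝ))
    (μ := volume.restrict (Ioi (0 : ℝ)))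
    (F := fun z s => s ^ (μ - 1) * Real.exp (-s - (s / z) ^ 2 / 2))
    (f := fun s => Real.exp (-s) * s ^ (μ - 1))
    (fun s => Real.exp (-s) * s ^ (μ - 1)) (.of_forall fun z => by fun_prop) ?_
    (Real.GammaIntegral_convergent hμ) ?_
  · rw [← Real.Gamma_eq_integral hμ] at key
    refine key.congr' ?_
    filter_upwards [eventually_gt_atTop 0] with z hz using (rpow_mul_cylInt hz).symm
  · filter_upwards with z
    filter_upwards [ae_restrict_mem measurableSet_Ioi] with s hs
    have hs' : (0 : ℝ) < s := hs
    rw [Real.norm_of_nonneg (by positivity), mul_comm]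
    gcongr
    have := sq_nonneg (s / z)
    linarith
  · refine .of_forall fun s => ?_
    have h0 : Tendsto (fun z : ℝ => s / z) atTop (𝓝 0) := tendsto_const_nhds.div_atTop tendsto_id
    have h1 : Tendsto (fun z : ℝ => -s - (s / z) ^ 2 / 2) atTop (𝓝 (-s - 0 ^ 2 / 2)) :=
      tendsto_const_nhds.sub ((h0.pow 2).div_const 2)
    have h2 := ((Real.continuous_exp.tendsto _).comp h1).const_mul (s ^ (μ - 1))
    simp only [ne_eq, OfNat.ofNat_ne_zero, not_false_eq_true, zero_pow, zero_div, sub_zero] at h2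
    rw [mul_comm (Real.exp (-s))]
    exact h2

lemma gaussMoment_add_two {s : ℝ} (hs : s ≠ 0) : gaussMoment (s + 2) = s * gaussMoment s := by
  rw [gaussMoment, gaussMoment, show (s + 2) / 2 = s / 2 + 1 by ring,
    Real.Gamma_add_one (by simpa using hs), add_sub_right_comm,
    Real.rpow_add_one (by norm_num)]
  ring

/-- The Pochhammer symbol of a real number. -/
def realPoch (a : ℝ) (n : ℕ) : ℝ := ∏ i ∈ Finset.range n, (a + i)

lemma realPoch_succ (a : ℝ) (n : ℕ) : realPoch a (n + 1) = realPoch a n * (a + n) :=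
  Finset.prod_range_succ _ _

lemma realPoch_pos {a : ℝ} (ha : 0 < a) (n : ℕ) : 0 < realPoch a n :=
  Finset.prod_pos fun _ _ => by positivity

/-- Kummer's function with real parameters and argument. -/
def realKummer (a b w : ℝ) : ℝ :=
  ∑' n : ℕ, realPoch a n / realPoch b n * w ^ n / n.factorial

lemma kummerM_ofReal (a b w : ℝ) : kummerM a b w = (realKummer a b w : ℂ) := by
  simp [kummerM, realKummer, poch, realPoch, Complex.ofReal_tsum]

lemma factorial_two_mul_eq (j : ℕ) :
    ((2 * j).factorial : ℝ) = 4 ^ j * j.factorial * realPoch (1 / 2) j := by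
  induction j with
  | zero => simp [realPoch]
  | succ j ih =>
    rw [show 2 * (j + 1) = 2 * j + 1 + 1 by ring, Nat.factorial_succ, Nat.factorial_succ,
      realPoch_succ, Nat.factorial_succ]
    push_cast
    rw [ih]; ring

lemma factorial_two_mul_add_one_eq (j : ℕ) :
    ((2 * j + 1).factorial : ℝ) = 4 ^ j * j.factorial * realPoch (3 / 2) j := by
  induction j with
  | zero => simp [realPoch]
  | succ j ih =>
    rw [show 2 * (j + 1) + 1 = 2 * j + 1 + 1 + 1 by ring, Nat.factorial_succ (2 * j + 1 + 1),
      Nat.factorial_succ (2 * j + 1), realPoch_succ, Nat.factorial_succ j]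
    push_cast
    rw [ih]; ring

lemma gaussMoment_even {ν : ℝ} (hν : ν < 1) (j : ℕ) :
    gaussMoment (2 * j + 2 - ν) - 2 * j * gaussMoment (2 * j - ν)
      = gaussMoment (2 - ν) * (2 ^ j * realPoch (-ν / 2) j) := by
  have hrec : ∀ j : ℕ, gaussMoment (2 * ((j + 1 : ℕ) : ℝ) + 2 - ν)
      - 2 * ((j + 1 : ℕ) : ℝ) * gaussMoment (2 * ((j + 1 : ℕ) : ℝ) - ν)
      = -ν * gaussMoment (2 * j + 2 - ν) := fun j => by
    have : (2 * (j : ℝ) + 2 - ν) ≠ 0 := by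
      have : (0 : ℝ) ≤ j := j.cast_nonneg
      linarith
    push_cast
    rw [show 2 * ((j : ℝ) + 1) + 2 - ν = (2 * j + 2 - ν) + 2 by ring, gaussMoment_add_two this,
      show 2 * ((j : ℝ) + 1) - ν = 2 * j + 2 - ν by ring]
    ring
  have hclosed : ∀ j : ℕ, -ν * gaussMoment (2 * j + 2 - ν)
      = gaussMoment (2 - ν) * (2 ^ (j + 1) * realPoch (-ν / 2) (j + 1)) := fun j => by
    induction j with
    | zero => simp [realPoch]; ring
    | succ j ih =>
      have : (2 * (j : ℝ) + 2 - ν) ≠ 0 := by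
        have : (0 : ℝ) ≤ j := j.cast_nonneg
        linarith
      rw [realPoch_succ, pow_succ]
      push_cast
      rw [show 2 * ((j : ℝ) + 1) + 2 - ν = (2 * j + 2 - ν) + 2 by ring, gaussMoment_add_two this]
      linear_combination (2 * j + 2 - ν) * ih
  cases j with
  | zero => simp [realPoch]
  | succ j => rw [hrec, hclosed]

lemma gaussMoment_odd {ν : ℝ} (hν : ν < 1) (j : ℕ) :
    gaussMoment (2 * j + 3 - ν) - (2 * j + 1) * gaussMoment (2 * j + 1 - ν)
      = -ν * gaussMoment (1 - ν) * (2 ^ j * realPoch ((1 - ν) / 2) j) := by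
  have hne : ∀ j : ℕ, (2 * (j : ℝ) + 1 - ν) ≠ 0 := fun j => by
    have : (0 : ℝ) ≤ j := j.cast_nonneg
    linarith
  have h : ∀ j : ℕ, gaussMoment (2 * j + 1 - ν)
      = gaussMoment (1 - ν) * (2 ^ j * realPoch ((1 - ν) / 2) j) := fun j => by
    induction j with
    | zero => simp [realPoch]
    | succ j ih =>
      rw [realPoch_succ, pow_succ]
      push_cast
      rw [show 2 * ((j : ℝ) + 1) + 1 - ν = (2 * j + 1 - ν) + 2 by ring,
        gaussMoment_add_two (hne j)]
      linear_combination (2 * j + 1 - ν) * ih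
  rw [show 2 * (j : ℝ) + 3 - ν = (2 * j + 1 - ν) + 2 by ring, gaussMoment_add_two (hne j)]
  linear_combination (-ν) * h j

lemma hasSum_mul_cylInt_add {ν : ℝ} (hν : ν < 1) (z : ℝ) :
    HasSum (fun n : ℕ => (-z) ^ n / n.factorial *
        (gaussMoment (n + 2 - ν) - n * gaussMoment (n - ν)))
      (z * cylInt (1 - ν) z + cylInt (2 - ν) z) := by
  have h1 := hasSum_cylInt (μ := 1 - ν) (by linarith) z
  have h2 := hasSum_cylInt (μ := 2 - ν) (by linarith) z
  have h3 : HasSum (fun n : ℕ => -((-z) ^ n / n.factorial * (n * gaussMoment (n - ν))))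
      (z * cylInt (1 - ν) z) := by
    have h4 := (hasSum_nat_add_iff (f := fun n : ℕ =>
      -((-z) ^ n / n.factorial * (n * gaussMoment (n - ν)))) (g := z * cylInt (1 - ν) z) 1).1 ?_
    · simpa using h4
    · refine (h1.mul_left z).congr_fun fun n => ?_
      rw [Nat.factorial_succ]
      push_cast
      rw [show (n : ℝ) + 1 - ν = n + (1 - ν) by ring]
      have : (n.factorial : ℝ) ≠ 0 := by positivity
      field_simp
      ring
  refine (h3.add h2).congr_fun fun n => ?_
  rw [show (n : ℝ) + (2 - ν) = n + 2 - ν by ring]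
  ring

lemma mul_cylInt_add_eq {ν : ℝ} (hν : ν < 1) (z : ℝ) :
    z * cylInt (1 - ν) z + cylInt (2 - ν) z
      = gaussMoment (2 - ν) * realKummer (-ν / 2) (1 / 2) (z ^ 2 / 2)
        + ν * gaussMoment (1 - ν) * z * realKummer ((1 - ν) / 2) (3 / 2) (z ^ 2 / 2) := by
  have h := hasSum_mul_cylInt_add hν z
  set F : ℕ → ℝ := fun n => (-z) ^ n / n.factorial *
    (gaussMoment (n + 2 - ν) - n * gaussMoment (n - ν)) with hF
  have hp : ∀ j : ℕ, (4 : ℝ) ^ j = 2 ^ j * 2 ^ j := fun j => by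
    rw [← mul_pow]; norm_num
  have heven : ∀ j : ℕ, F (2 * j) = gaussMoment (2 - ν) *
      (realPoch (-ν / 2) j / realPoch (1 / 2) j * (z ^ 2 / 2) ^ j / j.factorial) := fun j => by
    have h1 := realPoch_pos (a := 1 / 2) (by norm_num) j
    have h2 : (j.factorial : ℝ) ≠ 0 := by positivity
    have e := gaussMoment_even hν j
    simp only [hF]
    rw [factorial_two_mul_eq, Nat.cast_mul, Nat.cast_two, e, hp, pow_mul, neg_sq, div_pow]
    field_simp
  have hodd : ∀ j : ℕ, F (2 * j + 1) = ν * gaussMoment (1 - ν) * z *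
      (realPoch ((1 - ν) / 2) j / realPoch (3 / 2) j * (z ^ 2 / 2) ^ j / j.factorial) := fun j => by
    have h1 := realPoch_pos (a := 3 / 2) (by norm_num) j
    have h2 : (j.factorial : ℝ) ≠ 0 := by positivity
    have e := gaussMoment_odd hν j
    simp only [hF]
    rw [factorial_two_mul_add_one_eq, Nat.cast_add, Nat.cast_mul, Nat.cast_two, Nat.cast_one,
      show 2 * (j : ℝ) + 1 + 2 - ν = 2 * j + 3 - ν by ring, e,
      hp, pow_succ, pow_mul, neg_sq, div_pow]
    field_simp
  have he := h.summable.comp_injective (i := fun j : ℕ => 2 * j)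
    (mul_right_injective₀ two_ne_zero)
  have ho := h.summable.comp_injective (i := fun j : ℕ => 2 * j + 1)
    ((add_left_injective 1).comp (mul_right_injective₀ two_ne_zero))
  rw [← h.tsum_eq, ← tsum_even_add_odd he ho, tsum_congr heven, tsum_congr hodd, tsum_mul_left,
    tsum_mul_left]
  rfl

/-- The function `e^{z²/4} D_{2α}(z)` for `z > 0`, through its integral representation. -/
def hermiteFn (α z : ℝ) : ℝ :=
  (z * cylInt (1 - 2 * α) z + cylInt (2 - 2 * α) z) / Real.Gamma (1 - 2 * α)

lemma gaussMoment_two_sub_div {ν : ℝ} (hν : ν < 1) :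
    gaussMoment (2 - ν) / Real.Gamma (1 - ν)
      = 2 ^ (ν / 2) * (√Real.pi / Real.Gamma ((1 - ν) / 2)) := by
  have hd := Real.Gamma_mul_Gamma_add_half ((1 - ν) / 2)
  have g1 : 0 < Real.Gamma ((1 - ν) / 2) := Real.Gamma_pos_of_pos (by linarith)
  have g2 : 0 < Real.Gamma (1 - ν) := Real.Gamma_pos_of_pos (by linarith)
  rw [show 2 * ((1 - ν) / 2) = 1 - ν by ring, show (1 - ν) / 2 + 1 / 2 = (2 - ν) / 2 by ring,
    show 1 - (1 - ν) = ν by ring] at hd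
  rw [gaussMoment, ← mul_div_assoc, div_eq_div_iff g2.ne' g1.ne']
  have e : (2 : ℝ) ^ ((2 - ν) / 2 - 1) * 2 ^ ν = 2 ^ (ν / 2) := by
    rw [← Real.rpow_add (by norm_num)]; congr 1; ring
  rw [← e]
  linear_combination (2 : ℝ) ^ ((2 - ν) / 2 - 1) * hd

lemma mul_gaussMoment_one_sub_div {ν : ℝ} (hν : ν < 1) :
    ν * gaussMoment (1 - ν) / Real.Gamma (1 - ν) * √2
      = 2 ^ (ν / 2) * (-(2 * √Real.pi) / Real.Gamma (-ν / 2)) := by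
  rcases eq_or_ne ν 0 with rfl | h0
  · simp
  have hd := Real.Gamma_mul_Gamma_add_half ((1 - ν) / 2)
  have g1 : 0 < Real.Gamma ((1 - ν) / 2) := Real.Gamma_pos_of_pos (by linarith)
  have g2 : 0 < Real.Gamma (1 - ν) := Real.Gamma_pos_of_pos (by linarith)
  have g3 : 0 < Real.Gamma (-ν / 2 + 1) := Real.Gamma_pos_of_pos (by linarith)
  have h4 : -ν / 2 ≠ 0 := by simpa using h0
  have hr := Real.Gamma_add_one h4
  have g4 : Real.Gamma (-ν / 2) ≠ 0 := fun h => by rw [h, mul_zero] at hr; exact g3.ne' hr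
  rw [show 2 * ((1 - ν) / 2) = 1 - ν by ring, show (1 - ν) / 2 + 1 / 2 = -ν / 2 + 1 by ring,
    show 1 - (1 - ν) = ν by ring, hr] at hd
  have e : (2 : ℝ) ^ ((1 - ν) / 2 - 1) * 2 ^ ν * √2 = 2 ^ (ν / 2) := by
    rw [Real.sqrt_eq_rpow, ← Real.rpow_add (by norm_num), ← Real.rpow_add (by norm_num)]
    congr 1; ring
  rw [gaussMoment, div_mul_eq_mul_div, ← mul_div_assoc, div_eq_div_iff g2.ne' g4, ← e]
  linear_combination (-2 * (2 : ℝ) ^ ((1 - ν) / 2 - 1) * √2) * hd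

lemma Dr_eq {α z : ℝ} (hα : α < 1 / 2) (hz : 0 < z) :
    Dr (2 * α) z = Real.exp (-z ^ 2 / 4) * hermiteFn α z := by
  set ν := 2 * α with hν
  have hν1 : ν < 1 := by linarith
  have hG : Real.Gamma (-1 / 2) = -(2 * √Real.pi) := by
    have h := Real.Gamma_add_one (s := -1 / 2) (by norm_num)
    rw [show (-1 / 2 : ℝ) + 1 = 1 / 2 by norm_num, Real.Gamma_one_half_eq] at h
    linarith
  have hU : tricomiU (-(ν : ℂ) / 2) (1 / 2) ((z : ℂ) ^ 2 / 2)
      = ((√Real.pi / Real.Gamma ((1 - ν) / 2) * realKummer (-ν / 2) (1 / 2) (z ^ 2 / 2)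
        + -(2 * √Real.pi) / Real.Gamma (-ν / 2) * (z / √2)
          * realKummer ((1 - ν) / 2) (3 / 2) (z ^ 2 / 2) : ℝ) : ℂ) := by
    have e1 : (1 : ℂ) - 1 / 2 = ((1 / 2 : ℝ) : ℂ) := by push_cast; norm_num
    have e2 : (1 / 2 : ℂ) - 1 = ((-1 / 2 : ℝ) : ℂ) := by push_cast; norm_num
    have e3 : -(ν : ℂ) / 2 + 1 - 1 / 2 = (((1 - ν) / 2 : ℝ) : ℂ) := by push_cast; ring
    have e4 : -(ν : ℂ) / 2 - 1 / 2 + 1 = (((1 - ν) / 2 : ℝ) : ℂ) := by push_cast; ring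
    have e5 : (2 : ℂ) - 1 / 2 = ((3 / 2 : ℝ) : ℂ) := by push_cast; norm_num
    have e6 : -(ν : ℂ) / 2 = ((-ν / 2 : ℝ) : ℂ) := by push_cast; ring
    have e7 : (1 / 2 : ℂ) = ((1 / 2 : ℝ) : ℂ) := by push_cast; norm_num
    have e8 : (z : ℂ) ^ 2 / 2 = ((z ^ 2 / 2 : ℝ) : ℂ) := by push_cast; ring
    have e9 : (z ^ 2 / 2) ^ (1 / 2 : ℝ) = z / √2 := by
      rw [← Real.sqrt_eq_rpow, Real.sqrt_div (by positivity), Real.sqrt_sq hz.le]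
    rw [tricomiU, e1, e2, e3, e4, e5, e6, e7, e8, kummerM_ofReal, kummerM_ofReal,
      Complex.Gamma_ofReal, Complex.Gamma_ofReal, Complex.Gamma_ofReal, Complex.Gamma_ofReal,
      ← Complex.ofReal_cpow (by positivity), e9, hG, Real.Gamma_one_half_eq]
    push_cast
    ring
  have e10 : (2 : ℂ) ^ ((ν : ℂ) / 2) = ((2 ^ (ν / 2) : ℝ) : ℂ) := by
    rw [Complex.ofReal_cpow (by norm_num)]; push_cast; rfl
  have e11 : Complex.exp (-(z : ℂ) ^ 2 / 4) = ((Real.exp (-z ^ 2 / 4) : ℝ) : ℂ) := by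
    push_cast; rfl
  rw [Dr, cylinderD, hU, e10, e11, ← Complex.ofReal_mul, ← Complex.ofReal_mul, Complex.ofReal_re,
    hermiteFn, ← hν, mul_cylInt_add_eq hν1]
  have k1 := gaussMoment_two_sub_div hν1
  have k2 := mul_gaussMoment_one_sub_div hν1
  have hs : √(2 : ℝ) ≠ 0 := by positivity
  have k3 : ν * gaussMoment (1 - ν) / Real.Gamma (1 - ν)
      = 2 ^ (ν / 2) * (-(2 * √Real.pi) / Real.Gamma (-ν / 2)) / √2 := by
    rw [← k2]; field_simp
  have k4 : (gaussMoment (2 - ν) * realKummer (-ν / 2) (1 / 2) (z ^ 2 / 2) +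
      ν * gaussMoment (1 - ν) * z * realKummer ((1 - ν) / 2) (3 / 2) (z ^ 2 / 2)) /
        Real.Gamma (1 - ν)
      = gaussMoment (2 - ν) / Real.Gamma (1 - ν) * realKummer (-ν / 2) (1 / 2) (z ^ 2 / 2) +
        ν * gaussMoment (1 - ν) / Real.Gamma (1 - ν) *
          (z * realKummer ((1 - ν) / 2) (3 / 2) (z ^ 2 / 2)) := by ring
  rw [k4, k1, k3]
  ring

lemma rpow_mul_cylInt_le {μ z : ℝ} (hμ : 0 < μ) (hz : 0 < z) :
    z ^ μ * cylInt μ z ≤ Real.Gamma μ := by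
  rw [rpow_mul_cylInt hz, Real.Gamma_eq_integral hμ]
  refine integral_mono_of_nonneg ?_ (Real.GammaIntegral_convergent hμ) ?_
  · filter_upwards [ae_restrict_mem measurableSet_Ioi] with s hs
    have hs' : (0 : ℝ) < s := hs
    simp only [Pi.zero_apply]
    positivity
  · filter_upwards [ae_restrict_mem measurableSet_Ioi] with s hs
    have hs' : (0 : ℝ) < s := hs
    rw [mul_comm]
    gcongr
    have := sq_nonneg (s / z)
    linarith

lemma rpow_neg_mul_hermiteFn {α z : ℝ} (hz : 0 < z) :
    z ^ (-(2 * α)) * hermiteFn α z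
      = (z ^ (1 - 2 * α) * cylInt (1 - 2 * α) z
        + (z ^ 2)⁻¹ * (z ^ (2 - 2 * α) * cylInt (2 - 2 * α) z)) / Real.Gamma (1 - 2 * α) := by
  rw [hermiteFn, sub_eq_add_neg, sub_eq_add_neg, Real.rpow_add hz, Real.rpow_add hz,
    Real.rpow_one, Real.rpow_two]
  field_simp

lemma tendsto_rpow_neg_mul_hermiteFn {α : ℝ} (hα : α < 1 / 2) :
    Tendsto (fun z => z ^ (-(2 * α)) * hermiteFn α z) atTop (𝓝 1) := by
  have h1 := tendsto_rpow_mul_cylInt (μ := 1 - 2 * α) (by linarith)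
  have h2 := tendsto_rpow_mul_cylInt (μ := 2 - 2 * α) (by linarith)
  have h3 : Tendsto (fun z : ℝ => (z ^ 2)⁻¹) atTop (𝓝 0) :=
    tendsto_inv_atTop_zero.comp (tendsto_pow_atTop two_ne_zero)
  have h4 := (h1.add (h3.mul h2)).div_const (Real.Gamma (1 - 2 * α))
  have g : Real.Gamma (1 - 2 * α) ≠ 0 := (Real.Gamma_pos_of_pos (by linarith)).ne'
  rw [zero_mul, add_zero, div_self g] at h4
  refine h4.congr' ?_
  filter_upwards [eventually_gt_atTop 0] with z hz using (rpow_neg_mul_hermiteFn hz).symm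

lemma exists_abs_rpow_neg_mul_hermiteFn_le {α : ℝ} (hα : α < 1 / 2) :
    ∃ C : ℝ, 0 ≤ C ∧ ∀ z : ℝ, 1 ≤ z → |z ^ (-(2 * α)) * hermiteFn α z| ≤ C := by
  have g : 0 < Real.Gamma (1 - 2 * α) := Real.Gamma_pos_of_pos (by linarith)
  have g2 : 0 < Real.Gamma (2 - 2 * α) := Real.Gamma_pos_of_pos (by linarith)
  refine ⟨(Real.Gamma (1 - 2 * α) + 1 * Real.Gamma (2 - 2 * α)) / Real.Gamma (1 - 2 * α),
    by positivity, fun z hz => ?_⟩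
  have hz0 : 0 < z := by linarith
  have c1 := cylInt_nonneg (1 - 2 * α) z
  have c2 := cylInt_nonneg (2 - 2 * α) z
  rw [rpow_neg_mul_hermiteFn hz0, abs_of_nonneg (by positivity)]
  gcongr
  · exact rpow_mul_cylInt_le (by linarith) hz0
  · exact inv_le_one_of_one_le₀ (one_le_pow₀ hz)
  · exact rpow_mul_cylInt_le (by linarith) hz0

lemma hasDerivAt_hermiteFn {α z : ℝ} (hα : α < 1 / 2) (hz : 0 < z) :
    HasDerivAt (hermiteFn α) (2 * α * cylInt (1 - 2 * α) z / Real.Gamma (1 - 2 * α)) z := by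
  have h1 := hasDerivAt_cylInt (μ := 1 - 2 * α) (by linarith) hz
  have h2 := hasDerivAt_cylInt (μ := 2 - 2 * α) (by linarith) hz
  have h := (((hasDerivAt_id z).mul h1).add h2).div_const (Real.Gamma (1 - 2 * α))
  refine h.congr_deriv ?_
  have hr := cylInt_add_two (μ := 1 - 2 * α) (by linarith) z
  rw [show 1 - 2 * α + 2 = 2 - 2 * α + 1 by ring] at hr
  congr 1
  simp only [id]
  linear_combination -hr

/-- The factor `e^{-z²/4} D_{2α}(z)` of the product formula kernel. -/
def kerG (α z : ℝ) : ℝ := Real.exp (-z ^ 2 / 2) * hermiteFn α z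

/-- The derivative of `kerG`. -/
def kerG' (α z : ℝ) : ℝ :=
  Real.exp (-z ^ 2 / 2) *
    (2 * α * cylInt (1 - 2 * α) z / Real.Gamma (1 - 2 * α) - z * hermiteFn α z)

/-- The second derivative of `kerG`. -/
def kerG'' (α z : ℝ) : ℝ := -z * kerG' α z - (2 * α + 1) * kerG α z

lemma hasDerivAt_exp_neg_sq (z : ℝ) :
    HasDerivAt (fun z : ℝ => Real.exp (-z ^ 2 / 2)) (-z * Real.exp (-z ^ 2 / 2)) z := by
  have h : HasDerivAt (fun z : ℝ => -z ^ 2 / 2) (-z) z := by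
    refine ((hasDerivAt_pow 2 z).neg.div_const 2).congr_deriv ?_
    push_cast; ring
  exact h.exp.congr_deriv (by ring)

lemma hasDerivAt_kerG {α z : ℝ} (hα : α < 1 / 2) (hz : 0 < z) :
    HasDerivAt (kerG α) (kerG' α z) z :=
  ((hasDerivAt_exp_neg_sq z).mul (hasDerivAt_hermiteFn hα hz)).congr_deriv (by
    rw [kerG']; ring)

lemma hasDerivAt_kerG' {α z : ℝ} (hα : α < 1 / 2) (hz : 0 < z) :
    HasDerivAt (kerG' α) (kerG'' α z) z := by
  have h1 := ((hasDerivAt_cylInt (μ := 1 - 2 * α) (by linarith) hz).const_mul (2 * α)).div_const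
    (Real.Gamma (1 - 2 * α))
  have h2 := (hasDerivAt_id z).mul (hasDerivAt_hermiteFn hα hz)
  refine ((hasDerivAt_exp_neg_sq z).mul (h1.sub h2)).congr_deriv ?_
  rw [show 1 - 2 * α + 1 = 2 - 2 * α by ring, kerG'', kerG', kerG]
  simp only [id, hermiteFn, Pi.sub_apply, Pi.mul_apply]
  ring

lemma exists_kerG_bound {α : ℝ} (hα : α < 1 / 2) :
    ∃ C : ℝ, 0 ≤ C ∧ ∀ z : ℝ, 0 < z →
      |kerG α z| ≤ C * (1 + z) ^ 3 * Real.exp (-z ^ 2 / 2) ∧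
      |kerG' α z| ≤ C * (1 + z) ^ 3 * Real.exp (-z ^ 2 / 2) ∧
      |kerG'' α z| ≤ C * (1 + z) ^ 3 * Real.exp (-z ^ 2 / 2) := by
  set g := Real.Gamma (1 - 2 * α) with hg
  have g0 : 0 < g := Real.Gamma_pos_of_pos (by linarith)
  set A := cylInt (1 - 2 * α) 0 / g with hA
  set B := cylInt (2 - 2 * α) 0 / g with hB
  have A0 : 0 ≤ A := div_nonneg (cylInt_nonneg _ _) g0.le
  have B0 : 0 ≤ B := div_nonneg (cylInt_nonneg _ _) g0.le
  set M := A + B + |2 * α| * A with hM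
  have M0 : 0 ≤ M := by positivity
  refine ⟨M + |2 * α + 1| * M, by positivity, fun z hz => ?_⟩
  set e := Real.exp (-z ^ 2 / 2) with he
  have e0 : 0 < e := Real.exp_pos _
  have a1 : cylInt (1 - 2 * α) z / g ≤ A := by
    rw [hA]; gcongr; exact cylInt_le_zero (by linarith) hz.le
  have b1 : cylInt (2 - 2 * α) z / g ≤ B := by
    rw [hB]; gcongr; exact cylInt_le_zero (by linarith) hz.le
  have a0 : 0 ≤ cylInt (1 - 2 * α) z / g := div_nonneg (cylInt_nonneg _ _) g0.le
  have b0 : 0 ≤ cylInt (2 - 2 * α) z / g := div_nonneg (cylInt_nonneg _ _) g0.le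
  have hh : hermiteFn α z = z * (cylInt (1 - 2 * α) z / g) + cylInt (2 - 2 * α) z / g := by
    rw [hermiteFn]; ring
  have h0 : 0 ≤ hermiteFn α z := by rw [hh]; positivity
  have h1 : hermiteFn α z ≤ (A + B) * (1 + z) := by
    rw [hh]; nlinarith [mul_nonneg hz.le (sub_nonneg.2 a1), mul_nonneg hz.le B0]
  have hd : |2 * α * cylInt (1 - 2 * α) z / g| ≤ |2 * α| * A := by
    rw [mul_div_assoc, abs_mul, abs_of_nonneg a0]; gcongr
  have k0 : |kerG α z| ≤ M * (1 + z) * e := by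
    rw [kerG, abs_mul, abs_of_pos e0, abs_of_nonneg h0, mul_comm]
    gcongr
    refine h1.trans ?_
    gcongr
    have : 0 ≤ |2 * α| * A := by positivity
    linarith
  have k1 : |kerG' α z| ≤ M * (1 + z) ^ 2 * e := by
    rw [kerG', abs_mul, abs_of_pos e0, mul_comm]
    gcongr
    refine (abs_sub _ _).trans ?_
    rw [abs_of_nonneg (mul_nonneg hz.le h0)]
    have h2 : z * hermiteFn α z ≤ z * ((A + B) * (1 + z)) := by gcongr
    have h3 : 0 ≤ |2 * α| * A := by positivity
    have h4 : 0 ≤ (A + B) * (1 + z) := by positivity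
    have h5 : |2 * α| * A * 1 ≤ |2 * α| * A * (1 + z) ^ 2 := by
      gcongr; exact one_le_pow₀ (by linarith)
    calc _ ≤ |2 * α| * A + z * ((A + B) * (1 + z)) := add_le_add hd h2
      _ ≤ M * (1 + z) ^ 2 := by rw [hM]; nlinarith
  have p1 : (1 : ℝ) ≤ 1 + z := by linarith
  have q1 : (1 + z) ≤ (1 + z) ^ 3 := le_self_pow₀ p1 (by norm_num)
  have q2 : (1 + z) ^ 2 ≤ (1 + z) ^ 3 := pow_le_pow_right₀ p1 (by norm_num)
  have hMM : M ≤ M + |2 * α + 1| * M := le_add_of_nonneg_right (by positivity)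
  refine ⟨k0.trans (by gcongr), k1.trans (by gcongr), ?_⟩
  rw [kerG'']
  calc _ ≤ |-z * kerG' α z| + |(2 * α + 1) * kerG α z| := abs_sub _ _
    _ = z * |kerG' α z| + |2 * α + 1| * |kerG α z| := by
      rw [abs_mul, abs_mul, abs_neg, abs_of_pos hz]
    _ ≤ (1 + z) * (M * (1 + z) ^ 2 * e) + |2 * α + 1| * (M * (1 + z) ^ 3 * e) := by
      gcongr
      · linarith
      · exact k0.trans (by gcongr)
    _ = _ := by ring

lemma exists_rpow_le_mul_sq_add {β δ : ℝ} (hβ0 : 0 ≤ β) (hβ : β < 2) (hδ : 0 < δ) :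
    ∃ C : ℝ, 0 ≤ C ∧ ∀ t : ℝ, 0 < t → t ^ β ≤ δ * t ^ 2 + C := by
  have h := tendsto_rpow_neg_atTop (y := 2 - β) (by linarith)
  obtain ⟨T, hT⟩ := eventually_atTop.1 ((h.eventually (ge_mem_nhds hδ)).and (eventually_gt_atTop 0))
  have hT0 : 0 < T := (hT T le_rfl).2
  refine ⟨T ^ β, by positivity, fun t ht => ?_⟩
  rcases le_total T t with h1 | h1
  · have h2 := (hT t h1).1
    have h3 : t ^ β = t ^ (-(2 - β)) * t ^ 2 := by
      rw [← Real.rpow_two, ← Real.rpow_add ht]; congr 1; ring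
    have h4 : 0 ≤ T ^ β := by positivity
    rw [h3]
    nlinarith [mul_le_mul_of_nonneg_right h2 (sq_nonneg t)]
  · have h2 : t ^ β ≤ T ^ β := Real.rpow_le_rpow ht.le h1 hβ0
    have h3 := mul_nonneg hδ.le (sq_nonneg t)
    linarith

lemma exists_growth_bound (p b β ε : ℝ) (N : ℕ) (hb : 0 ≤ b) (hβ0 : 0 ≤ β) (hβ : β < 2)
    (hε : 0 < ε) :
    ∃ C : ℝ, 0 ≤ C ∧ ∀ ξ : ℝ, 0 < ξ →
      ξ ^ p * (ξ + ξ⁻¹) ^ N * Real.exp (b * (ξ ^ (-β) + ξ ^ β))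
        ≤ C * Real.exp (ε * ((ξ ^ 2)⁻¹ + ξ ^ 2)) := by
  set A : ℝ := |p| + N with hA
  have A0 : 0 ≤ A := by positivity
  obtain ⟨C₁, hC₁, h₁⟩ := exists_rpow_le_mul_sq_add (β := 1) (δ := ε / 2 / (A + 1))
    (by norm_num) (by norm_num) (by positivity)
  obtain ⟨C₂, hC₂, h₂⟩ := exists_rpow_le_mul_sq_add (δ := ε / 2 / (b + 1))
    hβ0 hβ (by positivity)
  have key : ∀ t : ℝ, 0 < t → A * t + b * t ^ β ≤ ε * t ^ 2 + (A * C₁ + b * C₂) := fun t ht => by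
    have e1 := mul_le_mul_of_nonneg_left (h₁ t ht) A0
    have e2 := mul_le_mul_of_nonneg_left (h₂ t ht) hb
    rw [Real.rpow_one] at e1
    have e3 : A * (ε / 2 / (A + 1)) ≤ ε / 2 := by
      rw [mul_div_assoc', div_le_iff₀ (by positivity)]; nlinarith
    have e4 : b * (ε / 2 / (b + 1)) ≤ ε / 2 := by
      rw [mul_div_assoc', div_le_iff₀ (by positivity)]; nlinarith
    have e5 := mul_le_mul_of_nonneg_right e3 (sq_nonneg t)
    have e6 := mul_le_mul_of_nonneg_right e4 (sq_nonneg t)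
    linarith
  refine ⟨Real.exp (2 * (A * C₁ + b * C₂)), (Real.exp_pos _).le, fun ξ hξ => ?_⟩
  have hi : 0 < ξ⁻¹ := inv_pos.2 hξ
  have k1 := key ξ hξ
  have k2 := key ξ⁻¹ hi
  have l1 : Real.log ξ * p ≤ |p| * (ξ + ξ⁻¹) := by
    have a1 := Real.log_le_sub_one_of_pos hξ
    have a2 := Real.log_le_sub_one_of_pos hi
    rw [Real.log_inv] at a2
    have a3 : |Real.log ξ| ≤ ξ + ξ⁻¹ := abs_le.2 ⟨by linarith, by linarith⟩
    calc _ ≤ |Real.log ξ * p| := le_abs_self _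
      _ = |p| * |Real.log ξ| := by rw [abs_mul, mul_comm]
      _ ≤ _ := by gcongr
  have l2 : (ξ + ξ⁻¹) ^ N ≤ Real.exp (N * (ξ + ξ⁻¹)) := by
    rw [Real.exp_nat_mul]
    gcongr
    have := Real.add_one_le_exp (ξ + ξ⁻¹)
    linarith
  have e : ξ ^ (-β) = ξ⁻¹ ^ β := by rw [Real.rpow_neg hξ.le, Real.inv_rpow hξ.le]
  rw [← Real.exp_add, Real.rpow_def_of_pos hξ, e]
  calc _ ≤ Real.exp (Real.log ξ * p) * Real.exp (N * (ξ + ξ⁻¹))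
        * Real.exp (b * (ξ⁻¹ ^ β + ξ ^ β)) := by gcongr
    _ = Real.exp (Real.log ξ * p + N * (ξ + ξ⁻¹) + b * (ξ⁻¹ ^ β + ξ ^ β)) := by
      rw [← Real.exp_add, ← Real.exp_add]
    _ ≤ _ := by
      apply Real.exp_le_exp.2
      rw [inv_pow] at k2
      rw [hA] at k1 k2 ⊢
      linarith

/-- The argument of the parabolic cylinder function in the product formula kernel. -/
def kerArg (x y ξ : ℝ) : ℝ := (x ^ 2 + y ^ 2 + ξ ^ 2) / (2 * x * y * ξ)

/-- The partial derivative of `kerArg` in its first variable. -/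
def kerArg' (x y ξ : ℝ) : ℝ := (x ^ 2 - y ^ 2 - ξ ^ 2) / (2 * x ^ 2 * y * ξ)

/-- The second partial derivative of `kerArg` in its first variable. -/
def kerArg'' (x y ξ : ℝ) : ℝ := (y ^ 2 + ξ ^ 2) / (x ^ 3 * y * ξ)

lemma kerArg_comm (x y ξ : ℝ) : kerArg x y ξ = kerArg y x ξ := by
  rw [kerArg, kerArg]; ring

lemma kerArg_pos {x y ξ : ℝ} (hx : 0 < x) (hy : 0 < y) (hξ : 0 < ξ) : 0 < kerArg x y ξ := by
  unfold kerArg; positivity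

lemma hasDerivAt_kerArg {x y ξ : ℝ} (hx : 0 < x) (hy : 0 < y) (hξ : 0 < ξ) :
    HasDerivAt (fun x => kerArg x y ξ) (kerArg' x y ξ) x := by
  have h1 : HasDerivAt (fun x : ℝ => x ^ 2 + y ^ 2 + ξ ^ 2) (2 * x) x := by
    simpa using ((hasDerivAt_pow 2 x).add_const (y ^ 2)).add_const (ξ ^ 2)
  have h2 : HasDerivAt (fun x : ℝ => 2 * x * y * ξ) (2 * y * ξ) x := by
    simpa using (((hasDerivAt_id x).const_mul 2).mul_const y).mul_const ξ
  refine (h1.div h2 (by positivity)).congr_deriv ?_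
  rw [kerArg']
  field_simp
  ring

lemma hasDerivAt_kerArg' {x y ξ : ℝ} (hx : 0 < x) (hy : 0 < y) (hξ : 0 < ξ) :
    HasDerivAt (fun x => kerArg' x y ξ) (kerArg'' x y ξ) x := by
  have h1 : HasDerivAt (fun x : ℝ => x ^ 2 - y ^ 2 - ξ ^ 2) (2 * x) x := by
    simpa using ((hasDerivAt_pow 2 x).sub_const (y ^ 2)).sub_const (ξ ^ 2)
  have h2 : HasDerivAt (fun x : ℝ => 2 * x ^ 2 * y * ξ) (2 * (2 * x) * y * ξ) x := by
    simpa using (((hasDerivAt_pow 2 x).const_mul 2).mul_const y).mul_const ξ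
  refine (h1.div h2 (by positivity)).congr_deriv ?_
  rw [kerArg'']
  field_simp
  ring

lemma abs_kerArg'_le {x y ξ : ℝ} (hx : 0 < x) (hy : 0 < y) (hξ : 0 < ξ) :
    |kerArg' x y ξ| ≤ kerArg x y ξ / x := by
  rw [kerArg', kerArg, abs_div, abs_of_pos (a := 2 * x ^ 2 * y * ξ) (by positivity), div_div,
    show 2 * x * y * ξ * x = 2 * x ^ 2 * y * ξ by ring]
  gcongr
  exact abs_le.2 ⟨by nlinarith [sq_nonneg x], by nlinarith [sq_nonneg y, sq_nonneg ξ]⟩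

lemma abs_kerArg''_le {x y ξ : ℝ} (hx : 0 < x) (hy : 0 < y) (hξ : 0 < ξ) :
    |kerArg'' x y ξ| ≤ 2 * kerArg x y ξ / x ^ 2 := by
  rw [abs_of_nonneg (by unfold kerArg''; positivity), kerArg'', kerArg,
    show 2 * ((x ^ 2 + y ^ 2 + ξ ^ 2) / (2 * x * y * ξ)) / x ^ 2
      = (x ^ 2 + y ^ 2 + ξ ^ 2) / (x ^ 3 * y * ξ) by field_simp]
  gcongr
  nlinarith [sq_nonneg x]

lemma kerArg_sq_half {x y ξ : ℝ} (hx : 0 < x) (hy : 0 < y) (hξ : 0 < ξ) :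
    kerArg x y ξ ^ 2 / 2 = 1 / (2 * ξ ^ 2) + (x ^ 2 - y ^ 2) ^ 2 / (8 * x ^ 2 * y ^ 2) * (ξ ^ 2)⁻¹
      + (x ^ 2 + y ^ 2) / (4 * x ^ 2 * y ^ 2) + ξ ^ 2 / (8 * x ^ 2 * y ^ 2) := by
  rw [kerArg]
  field_simp
  ring

/-- Locally uniform Gaussian domination of the integrands, away from the diagonal. -/
lemma exists_kernel_domination {f : ℝ → ℝ} (hf : InE f) (α : ℝ) {x₀ y : ℝ} (hx₀ : 0 < x₀)
    (hy : 0 < y) (hne : x₀ ≠ y) :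
    ∃ s ∈ 𝓝 x₀, ∃ C ε : ℝ, 0 ≤ C ∧ 0 < ε ∧ ∀ x ∈ s, x₀ / 2 < x ∧ ∀ ξ : ℝ, 0 < ξ →
      |f ξ * ξ ^ (-(2 * α))| * ((1 + kerArg x y ξ) ^ 5 * Real.exp (-kerArg x y ξ ^ 2 / 2))
        ≤ C * Real.exp (-ε * ξ ^ 2) := by
  obtain ⟨-, b₁, b₂, β, hb₁, hb₂, hβ0, hβ, hfb⟩ := hf
  set d := min |x₀ - y| x₀ / 2 with hd
  have hd0 : 0 < d := half_pos (lt_min (abs_pos.2 (sub_ne_zero.2 hne)) hx₀)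
  have hd1 : 2 * d ≤ |x₀ - y| := by rw [hd]; linarith [min_le_left |x₀ - y| x₀]
  have hd2 : 2 * d ≤ x₀ := by rw [hd]; linarith [min_le_right |x₀ - y| x₀]
  set B := 2 * x₀ with hB
  set ε := min (d ^ 2 / (8 * B ^ 2)) (1 / (8 * B ^ 2 * y ^ 2)) / 2 with hε
  have hε0 : 0 < ε := by rw [hε]; positivity
  have hε1 : 2 * ε ≤ d ^ 2 / (8 * B ^ 2) := by
    rw [hε]; linarith [min_le_left (d ^ 2 / (8 * B ^ 2)) (1 / (8 * B ^ 2 * y ^ 2))]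
  have hε2 : 2 * ε ≤ 1 / (8 * B ^ 2 * y ^ 2) := by
    rw [hε]; linarith [min_le_right (d ^ 2 / (8 * B ^ 2)) (1 / (8 * B ^ 2 * y ^ 2))]
  obtain ⟨C, hC, hgr⟩ := exists_growth_bound (-(2 * α)) b₂ β ε 5 hb₂ hβ0 hβ hε0
  set K := 1 + (B ^ 2 + y ^ 2) / (x₀ * y) + 1 / (x₀ * y) with hK
  have hK0 : 0 ≤ K := by positivity
  refine ⟨Metric.ball x₀ d, Metric.ball_mem_nhds _ hd0, b₁ * K ^ 5 * C, ε, by positivity, hε0,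
    fun x hx => ?_⟩
  rw [Metric.mem_ball, Real.dist_eq, abs_lt] at hx
  have hxl : x₀ / 2 < x := by linarith
  have hx0 : 0 < x := by linarith
  have hxB : x ≤ B := by linarith
  refine ⟨hxl, fun ξ hξ => ?_⟩
  have hxy : d ≤ |x - y| := by
    rcases abs_cases (x₀ - y) with h | h <;> rcases abs_cases (x - y) with h' | h' <;> linarith
  have hi : 0 < ξ⁻¹ := inv_pos.2 hξ
  have hη : 1 ≤ ξ + ξ⁻¹ := by
    rcases le_total 1 ξ with h | h
    · linarith
    · linarith [(one_le_inv₀ hξ).2 h]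
  have hz : 1 + kerArg x y ξ ≤ K * (ξ + ξ⁻¹) := by
    have e1 : kerArg x y ξ ≤ (B ^ 2 + y ^ 2 + ξ ^ 2) / (x₀ * y * ξ) := by
      rw [kerArg]
      gcongr
      linarith
    have e2 : (B ^ 2 + y ^ 2 + ξ ^ 2) / (x₀ * y * ξ)
        = (B ^ 2 + y ^ 2) / (x₀ * y) * ξ⁻¹ + 1 / (x₀ * y) * ξ := by field_simp
    have e3 : 0 ≤ (B ^ 2 + y ^ 2) / (x₀ * y) * ξ := by positivity
    have e4 : 0 ≤ 1 / (x₀ * y) * ξ⁻¹ := by positivity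
    rw [hK]
    linarith
  have hexp : 1 / (2 * ξ ^ 2) + 2 * ε * ((ξ ^ 2)⁻¹ + ξ ^ 2) ≤ kerArg x y ξ ^ 2 / 2 := by
    rw [kerArg_sq_half hx0 hy hξ]
    have e1 : 2 * ε ≤ (x ^ 2 - y ^ 2) ^ 2 / (8 * x ^ 2 * y ^ 2) := by
      refine hε1.trans ?_
      have : (x ^ 2 - y ^ 2) ^ 2 = |x - y| ^ 2 * (x + y) ^ 2 := by rw [sq_abs]; ring
      rw [this]
      calc d ^ 2 / (8 * B ^ 2) = d ^ 2 * y ^ 2 / (8 * B ^ 2 * y ^ 2) := by field_simp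
        _ ≤ _ := by gcongr; linarith
    have e2 : 2 * ε * ξ ^ 2 ≤ ξ ^ 2 / (8 * x ^ 2 * y ^ 2) := by
      calc 2 * ε * ξ ^ 2 ≤ 1 / (8 * B ^ 2 * y ^ 2) * ξ ^ 2 := by gcongr
        _ = ξ ^ 2 / (8 * B ^ 2 * y ^ 2) := by ring
        _ ≤ _ := by gcongr
    have e3 : 0 ≤ (x ^ 2 + y ^ 2) / (4 * x ^ 2 * y ^ 2) := by positivity
    have e4 := mul_le_mul_of_nonneg_right e1 (by positivity : 0 ≤ (ξ ^ 2)⁻¹)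
    linarith
  have hk0 := kerArg_pos hx0 hy hξ
  rw [abs_mul, abs_of_nonneg (by positivity : 0 ≤ ξ ^ (-(2 * α)))]
  calc _ ≤ b₁ * Real.exp (1 / (2 * ξ ^ 2) + b₂ * (ξ ^ (-β) + ξ ^ β)) * ξ ^ (-(2 * α)) *
        ((K * (ξ + ξ⁻¹)) ^ 5
          * Real.exp (-(1 / (2 * ξ ^ 2) + 2 * ε * ((ξ ^ 2)⁻¹ + ξ ^ 2)))) := by
        gcongr
        · exact hfb ξ hξ
        · rw [neg_div]; exact neg_le_neg hexp
    _ = b₁ * K ^ 5 * (ξ ^ (-(2 * α)) * (ξ + ξ⁻¹) ^ 5 * Real.exp (b₂ * (ξ ^ (-β) + ξ ^ β)))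
        * Real.exp (-(2 * ε * ((ξ ^ 2)⁻¹ + ξ ^ 2))) := by
        rw [neg_add, Real.exp_add, Real.exp_add, Real.exp_neg (1 / (2 * ξ ^ 2))]
        have := Real.exp_ne_zero (1 / (2 * ξ ^ 2))
        field_simp
    _ ≤ b₁ * K ^ 5 * (C * Real.exp (ε * ((ξ ^ 2)⁻¹ + ξ ^ 2)))
        * Real.exp (-(2 * ε * ((ξ ^ 2)⁻¹ + ξ ^ 2))) :=
        mul_le_mul_of_nonneg_right (mul_le_mul_of_nonneg_left (hgr ξ hξ) (by positivity))
          (Real.exp_pos _).le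
    _ = b₁ * K ^ 5 * C * Real.exp (-ε * ((ξ ^ 2)⁻¹ + ξ ^ 2)) := by
        rw [← mul_assoc, mul_assoc, ← Real.exp_add]
        congr 2; ring
    _ ≤ _ := by
        refine mul_le_mul_of_nonneg_left (Real.exp_le_exp.2 ?_) (by positivity)
        have : 0 ≤ ε * (ξ ^ 2)⁻¹ := by positivity
        linarith

/-- The kernel `kerG` along `kerArg`, as a function of the first variable. -/
def ker0 (α y x ξ : ℝ) : ℝ := kerG α (kerArg x y ξ)

/-- The partial derivative of `ker0` in `x`. -/
def ker1 (α y x ξ : ℝ) : ℝ := kerG' α (kerArg x y ξ) * kerArg' x y ξ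

/-- The second partial derivative of `ker0` in `x`. -/
def ker2 (α y x ξ : ℝ) : ℝ :=
  kerG'' α (kerArg x y ξ) * kerArg' x y ξ ^ 2 + kerG' α (kerArg x y ξ) * kerArg'' x y ξ

section
variable {α y : ℝ}

lemma hasDerivAt_ker0 (hα : α < 1 / 2) (hy : 0 < y) {x ξ : ℝ} (hx : 0 < x) (hξ : 0 < ξ) :
    HasDerivAt (fun x => ker0 α y x ξ) (ker1 α y x ξ) x :=
  (hasDerivAt_kerG hα (kerArg_pos hx hy hξ)).comp x (hasDerivAt_kerArg hx hy hξ)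

lemma hasDerivAt_ker1 (hα : α < 1 / 2) (hy : 0 < y) {x ξ : ℝ} (hx : 0 < x) (hξ : 0 < ξ) :
    HasDerivAt (fun x => ker1 α y x ξ) (ker2 α y x ξ) x := by
  have h := (hasDerivAt_kerG' hα (kerArg_pos hx hy hξ)).comp x (hasDerivAt_kerArg hx hy hξ)
  refine (h.mul (hasDerivAt_kerArg' hx hy hξ)).congr_deriv ?_
  rw [ker2, Function.comp_apply]
  ring

lemma exists_ker_bound (hα : α < 1 / 2) (hy : 0 < y) {x₀ : ℝ} (hx₀ : 0 < x₀) :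
    ∃ A : ℝ, 0 ≤ A ∧ ∀ x, x₀ / 2 < x → ∀ ξ, 0 < ξ →
      |ker0 α y x ξ| ≤ A * ((1 + kerArg x y ξ) ^ 5 * Real.exp (-kerArg x y ξ ^ 2 / 2)) ∧
      |ker1 α y x ξ| ≤ A * ((1 + kerArg x y ξ) ^ 5 * Real.exp (-kerArg x y ξ ^ 2 / 2)) ∧
      |ker2 α y x ξ| ≤ A * ((1 + kerArg x y ξ) ^ 5 * Real.exp (-kerArg x y ξ ^ 2 / 2)) := by
  obtain ⟨C, hC, hb⟩ := exists_kerG_bound hα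
  set D := 2 / x₀ with hD
  have D0 : 0 < D := by positivity
  refine ⟨C * (1 + D) ^ 2, by positivity, fun x hx ξ hξ => ?_⟩
  have hx0 : 0 < x := by linarith
  have hz := kerArg_pos hx0 hy hξ
  have h1 := abs_kerArg'_le hx0 hy hξ
  have h2 := abs_kerArg''_le hx0 hy hξ
  have hxD : x⁻¹ ≤ D := by
    rw [hD, inv_le_comm₀ hx0 (by positivity), inv_div]
    exact hx.le
  obtain ⟨b0, b1, b2⟩ := hb _ hz
  set z := kerArg x y ξ with hzdef
  set e := Real.exp (-z ^ 2 / 2)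
  have e0 : 0 < e := Real.exp_pos _
  have h1' : |kerArg' x y ξ| ≤ D * z := by
    refine h1.trans ?_
    rw [div_eq_mul_inv, mul_comm]
    gcongr
  have h2' : |kerArg'' x y ξ| ≤ D ^ 2 * (2 * z) := by
    refine h2.trans ?_
    rw [div_eq_mul_inv, mul_comm, ← inv_pow]
    gcongr
  have hz1 : 1 ≤ 1 + z := by linarith
  have hD1 : 1 ≤ 1 + D := by linarith
  refine ⟨b0.trans ?_, ?_, ?_⟩
  · calc C * (1 + z) ^ 3 * e ≤ C * 1 ^ 2 * ((1 + z) ^ 5 * e) := by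
          rw [one_pow, mul_one, mul_assoc]
          gcongr
          · norm_num
      _ ≤ _ := by gcongr
  · calc |ker1 α y x ξ| ≤ (C * (1 + z) ^ 3 * e) * (D * z) := by
          rw [ker1, abs_mul]
          gcongr
      _ = C * D * ((1 + z) ^ 3 * z * e) := by ring
      _ ≤ C * (1 + D) ^ 2 * ((1 + z) ^ 5 * e) := by
          gcongr
          · nlinarith
          · calc (1 + z) ^ 3 * z ≤ (1 + z) ^ 3 * (1 + z) ^ 2 := by gcongr; nlinarith
              _ = _ := by ring
  · calc |ker2 α y x ξ| ≤ (C * (1 + z) ^ 3 * e) * (D * z) ^ 2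
          + (C * (1 + z) ^ 3 * e) * (D ^ 2 * (2 * z)) := by
          refine (abs_add_le _ _).trans ?_
          rw [abs_mul, abs_mul, abs_pow]
          gcongr
      _ = C * D ^ 2 * ((1 + z) ^ 3 * (z ^ 2 + 2 * z) * e) := by ring
      _ ≤ C * (1 + D) ^ 2 * ((1 + z) ^ 5 * e) := by
          gcongr
          · linarith
          · calc (1 + z) ^ 3 * (z ^ 2 + 2 * z) ≤ (1 + z) ^ 3 * (1 + z) ^ 2 := by gcongr; nlinarith
              _ = _ := by ring

lemma continuousOn_kerArg {x : ℝ} (hx : 0 < x) (hy : 0 < y) :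
    ContinuousOn (fun ξ => kerArg x y ξ) (Ioi 0) := by
  unfold kerArg
  refine ContinuousOn.div (by fun_prop) (by fun_prop) fun ξ hξ => ?_
  have : 0 < ξ := hξ
  positivity

lemma continuousOn_kerArg' {x : ℝ} (hx : 0 < x) (hy : 0 < y) :
    ContinuousOn (fun ξ => kerArg' x y ξ) (Ioi 0) := by
  unfold kerArg'
  refine ContinuousOn.div (by fun_prop) (by fun_prop) fun ξ hξ => ?_
  have : 0 < ξ := hξ
  positivity

lemma continuousOn_kerArg'' {x : ℝ} (hx : 0 < x) (hy : 0 < y) :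
    ContinuousOn (fun ξ => kerArg'' x y ξ) (Ioi 0) := by
  unfold kerArg''
  refine ContinuousOn.div (by fun_prop) (by fun_prop) fun ξ hξ => ?_
  have : 0 < ξ := hξ
  positivity

lemma continuousOn_kerG (hα : α < 1 / 2) : ContinuousOn (kerG α) (Ioi 0) := fun _ hz =>
  (hasDerivAt_kerG hα hz).continuousAt.continuousWithinAt

lemma continuousOn_kerG' (hα : α < 1 / 2) : ContinuousOn (kerG' α) (Ioi 0) := fun _ hz =>
  (hasDerivAt_kerG' hα hz).continuousAt.continuousWithinAt

lemma continuousOn_kerG'' (hα : α < 1 / 2) : ContinuousOn (kerG'' α) (Ioi 0) := by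
  have h1 := continuousOn_kerG hα
  have h2 := continuousOn_kerG' hα
  unfold kerG''
  fun_prop

lemma continuousOn_ker0 (hα : α < 1 / 2) {x : ℝ} (hx : 0 < x) (hy : 0 < y) :
    ContinuousOn (ker0 α y x) (Ioi 0) :=
  (continuousOn_kerG hα).comp (continuousOn_kerArg hx hy) fun _ hξ => kerArg_pos hx hy hξ

lemma continuousOn_ker1 (hα : α < 1 / 2) {x : ℝ} (hx : 0 < x) (hy : 0 < y) :
    ContinuousOn (ker1 α y x) (Ioi 0) :=
  ((continuousOn_kerG' hα).comp (continuousOn_kerArg hx hy)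
    fun _ hξ => kerArg_pos hx hy hξ).mul (continuousOn_kerArg' hx hy)

lemma continuousOn_ker2 (hα : α < 1 / 2) {x : ℝ} (hx : 0 < x) (hy : 0 < y) :
    ContinuousOn (ker2 α y x) (Ioi 0) :=
  (((continuousOn_kerG'' hα).comp (continuousOn_kerArg hx hy)
    fun _ hξ => kerArg_pos hx hy hξ).mul ((continuousOn_kerArg' hx hy).pow 2)).add
  (((continuousOn_kerG' hα).comp (continuousOn_kerArg hx hy)
    fun _ hξ => kerArg_pos hx hy hξ).mul (continuousOn_kerArg'' hx hy))

/-- Differentiation under the integral sign for kernels with Gaussian domination. -/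
lemma hasDerivAt_integral_of_ker_bound {f : ℝ → ℝ} (hf : InE f) (α : ℝ) {x₀ : ℝ} (hx₀ : 0 < x₀)
    (hy : 0 < y) (hne : x₀ ≠ y) {G G' : ℝ → ℝ → ℝ} {A : ℝ} (hA : 0 ≤ A)
    (hG : ∀ x, x₀ / 2 < x → ∀ ξ, 0 < ξ →
      |G x ξ| ≤ A * ((1 + kerArg x y ξ) ^ 5 * Real.exp (-kerArg x y ξ ^ 2 / 2)))
    (hG' : ∀ x, x₀ / 2 < x → ∀ ξ, 0 < ξ →
      |G' x ξ| ≤ A * ((1 + kerArg x y ξ) ^ 5 * Real.exp (-kerArg x y ξ ^ 2 / 2)))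
    (hcG : ∀ x, 0 < x → ContinuousOn (G x) (Ioi 0))
    (hcG' : ∀ x, 0 < x → ContinuousOn (G' x) (Ioi 0))
    (hd : ∀ x, 0 < x → ∀ ξ, 0 < ξ → HasDerivAt (fun x => G x ξ) (G' x ξ) x) :
    IntegrableOn (fun ξ => f ξ * ξ ^ (-(2 * α)) * G x₀ ξ) (Ioi 0) ∧
    IntegrableOn (fun ξ => f ξ * ξ ^ (-(2 * α)) * G' x₀ ξ) (Ioi 0) ∧
    HasDerivAt (fun x => ∫ ξ in Ioi 0, f ξ * ξ ^ (-(2 * α)) * G x ξ)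
      (∫ ξ in Ioi 0, f ξ * ξ ^ (-(2 * α)) * G' x₀ ξ) x₀ := by
  obtain ⟨s, hs, C, ε, hC, hε, hdom⟩ := exists_kernel_domination hf α hx₀ hy hne
  have hmw : AEStronglyMeasurable (fun ξ => f ξ * ξ ^ (-(2 * α))) (volume.restrict (Ioi 0)) :=
    (hf.1.mul (measurable_id.pow_const _)).aestronglyMeasurable
  have hm : ∀ {H : ℝ → ℝ}, ContinuousOn H (Ioi 0) →
      AEStronglyMeasurable (fun ξ => f ξ * ξ ^ (-(2 * α)) * H ξ) (volume.restrict (Ioi 0)) :=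
    fun hH => hmw.mul (hH.aestronglyMeasurable measurableSet_Ioi)
  have hbi : Integrable (fun ξ => A * (C * Real.exp (-ε * ξ ^ 2))) (volume.restrict (Ioi 0)) :=
    (((integrable_exp_neg_mul_sq hε).const_mul C).const_mul A).integrableOn
  have hbd : ∀ {H : ℝ → ℝ → ℝ}, (∀ x, x₀ / 2 < x → ∀ ξ, 0 < ξ →
      |H x ξ| ≤ A * ((1 + kerArg x y ξ) ^ 5 * Real.exp (-kerArg x y ξ ^ 2 / 2))) →
      ∀ᵐ ξ ∂(volume.restrict (Ioi 0)), ∀ x ∈ s,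
        ‖f ξ * ξ ^ (-(2 * α)) * H x ξ‖ ≤ A * (C * Real.exp (-ε * ξ ^ 2)) := by
    intro H hH
    filter_upwards [ae_restrict_mem measurableSet_Ioi] with ξ hξ x hx
    obtain ⟨h1, h2⟩ := hdom x hx
    rw [Real.norm_eq_abs, abs_mul]
    calc _ ≤ |f ξ * ξ ^ (-(2 * α))|
          * (A * ((1 + kerArg x y ξ) ^ 5 * Real.exp (-kerArg x y ξ ^ 2 / 2))) :=
          mul_le_mul_of_nonneg_left (hH x h1 ξ hξ) (abs_nonneg _)
      _ = A * (|f ξ * ξ ^ (-(2 * α))|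
          * ((1 + kerArg x y ξ) ^ 5 * Real.exp (-kerArg x y ξ ^ 2 / 2))) := by ring
      _ ≤ _ := mul_le_mul_of_nonneg_left (h2 ξ hξ) hA
  have hi : IntegrableOn (fun ξ => f ξ * ξ ^ (-(2 * α)) * G x₀ ξ) (Ioi 0) :=
    Integrable.mono' hbi (hm (hcG x₀ hx₀)) ((hbd hG).mono fun ξ h => h x₀ (mem_of_mem_nhds hs))
  refine ⟨hi, hasDerivAt_integral_of_dominated_loc_of_deriv_le
    (F := fun x ξ => f ξ * ξ ^ (-(2 * α)) * G x ξ)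
    (F' := fun x ξ => f ξ * ξ ^ (-(2 * α)) * G' x ξ) hs ?_ hi (hm (hcG' x₀ hx₀))
    (hbd hG') hbi ?_⟩
  · filter_upwards [lt_mem_nhds hx₀] with x hx using hm (hcG x hx)
  · filter_upwards [ae_restrict_mem measurableSet_Ioi] with ξ hξ x hx
    exact (hd x (by linarith [(hdom x hx).1]) ξ hξ).const_mul _

end

/-- `f` is twice differentiable at `x`. -/
def C2At (f : ℝ → ℝ) (x : ℝ) : Prop :=
  (∀ᶠ t in 𝓝 x, DifferentiableAt ℝ f t) ∧ DifferentiableAt ℝ (deriv f) x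

/-- The integral part of the translation operator, with kernel `G`. -/
def kerInt (α : ℝ) (f : ℝ → ℝ) (G : ℝ → ℝ) : ℝ :=
  ∫ ξ in Ioi 0, f ξ * ξ ^ (-(2 * α)) * G ξ

section
variable {α x y : ℝ} {f : ℝ → ℝ}

lemma hasDerivAt_kerInt (hα : α < 1 / 2) (hf : InE f) (hx : 0 < x) (hy : 0 < y) (hne : x ≠ y) :
    IntegrableOn (fun ξ => f ξ * ξ ^ (-(2 * α)) * ker0 α y x ξ) (Ioi 0) ∧
    HasDerivAt (fun x => kerInt α f (ker0 α y x)) (kerInt α f (ker1 α y x)) x := by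
  obtain ⟨A, hA, hb⟩ := exists_ker_bound hα hy hx
  have := hasDerivAt_integral_of_ker_bound hf α hx hy hne hA (G := ker0 α y) (G' := ker1 α y)
    (fun x hx ξ hξ => (hb x hx ξ hξ).1) (fun x hx ξ hξ => (hb x hx ξ hξ).2.1)
    (fun x hx => continuousOn_ker0 hα hx hy) (fun x hx => continuousOn_ker1 hα hx hy)
    (fun x hx ξ hξ => hasDerivAt_ker0 hα hy hx hξ)
  exact ⟨this.1, this.2.2⟩

lemma hasDerivAt_kerInt' (hα : α < 1 / 2) (hf : InE f) (hx : 0 < x) (hy : 0 < y) (hne : x ≠ y) :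
    IntegrableOn (fun ξ => f ξ * ξ ^ (-(2 * α)) * ker1 α y x ξ) (Ioi 0) ∧
    IntegrableOn (fun ξ => f ξ * ξ ^ (-(2 * α)) * ker2 α y x ξ) (Ioi 0) ∧
    HasDerivAt (fun x => kerInt α f (ker1 α y x)) (kerInt α f (ker2 α y x)) x := by
  obtain ⟨A, hA, hb⟩ := exists_ker_bound hα hy hx
  exact hasDerivAt_integral_of_ker_bound hf α hx hy hne hA (G := ker1 α y) (G' := ker2 α y)
    (fun x hx ξ hξ => (hb x hx ξ hξ).2.1) (fun x hx ξ hξ => (hb x hx ξ hξ).2.2)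
    (fun x hx => continuousOn_ker1 hα hx hy) (fun x hx => continuousOn_ker2 hα hx hy)
    (fun x hx ξ hξ => hasDerivAt_ker1 hα hy hx hξ)

/-- The prefactor of the translation kernel. -/
def kerS (α x : ℝ) : ℝ := x ^ (2 * α - 1) * Real.exp (1 / (2 * x ^ 2))

lemma translPos_integrand_eq (hα : α < 1 / 2) (hx : 0 < x) (hy : 0 < y) {ξ : ℝ} (hξ : 0 < ξ)
    (v : ℝ) : v * qk α x y ξ * mw α ξ
      = (2 * Real.pi) ^ (-(1 : ℝ) / 2) * kerS α x * kerS α y *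
        (v * ξ ^ (-(2 * α)) * ker0 α y x ξ) := by
  have hz := kerArg_pos hx hy hξ
  have e1 : ((x ^ 2 + y ^ 2 + ξ ^ 2) / (4 * x * y * ξ)) ^ 2 = kerArg x y ξ ^ 2 / 4 := by
    rw [kerArg]; field_simp; norm_num
  have e2 : (x * y * ξ) ^ (-1 + 2 * α)
      = x ^ (2 * α - 1) * y ^ (2 * α - 1) * ξ ^ (2 * α - 1) := by
    rw [Real.mul_rpow (by positivity) hξ.le, Real.mul_rpow hx.le hy.le]
    ring_nf
  have e3 : ξ ^ (-(2 * α)) = ξ ^ (2 * α - 1) * ξ ^ (1 - 4 * α) := by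
    rw [← Real.rpow_add hξ]; congr 1; ring
  have e4 : Real.exp (-kerArg x y ξ ^ 2 / 2)
      = Real.exp (-(kerArg x y ξ ^ 2 / 4)) * Real.exp (-kerArg x y ξ ^ 2 / 4) := by
    rw [← Real.exp_add]; congr 1; ring
  have e5 : Real.exp (-1 / (2 * ξ ^ 2)) = (Real.exp (1 / (2 * ξ ^ 2)))⁻¹ := by
    rw [← Real.exp_neg, neg_div]
  have e6 : Real.exp (1 / (2 * x ^ 2) + 1 / (2 * y ^ 2) + 1 / (2 * ξ ^ 2) - kerArg x y ξ ^ 2 / 4)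
      = Real.exp (1 / (2 * x ^ 2)) * Real.exp (1 / (2 * y ^ 2)) * Real.exp (1 / (2 * ξ ^ 2))
        * Real.exp (-(kerArg x y ξ ^ 2 / 4)) := by
    rw [← Real.exp_add, ← Real.exp_add, ← Real.exp_add, sub_eq_add_neg]
  have := Real.exp_ne_zero (1 / (2 * ξ ^ 2))
  rw [qk, mw, ker0, kerG, kerS, kerS, e1, e2, e3, e4, e5, ← kerArg, Dr_eq hα hz, e6]
  field_simp

lemma translPos_eq (hα : α < 1 / 2) (hx : 0 < x) (hy : 0 < y) :
    translPos α f y x = (2 * Real.pi) ^ (-(1 : ℝ) / 2) * kerS α x * kerS α y *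
      kerInt α f (ker0 α y x) := by
  rw [translPos, kerInt, ← integral_const_mul]
  exact setIntegral_congr_fun measurableSet_Ioi fun ξ hξ => translPos_integrand_eq hα hx hy hξ _

lemma ker0_comm (ξ : ℝ) : ker0 α y x ξ = ker0 α x y ξ := by
  rw [ker0, ker0, kerArg_comm]

lemma translPos_comm (hα : α < 1 / 2) (hx : 0 < x) (hy : 0 < y) :
    translPos α f y x = translPos α f x y := by
  rw [translPos_eq hα hx hy, translPos_eq hα hy hx]
  simp only [kerInt, ker0_comm (x := x) (y := y)]
  ring

/-- The logarithmic derivative of `kerS`. -/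
def kerR (α x : ℝ) : ℝ := (2 * α - 1) / x - 1 / x ^ 3

lemma hasDerivAt_kerS (hx : 0 < x) : HasDerivAt (kerS α) (kerS α x * kerR α x) x := by
  have h1 := Real.hasDerivAt_rpow_const (x := x) (p := 2 * α - 1) (Or.inl hx.ne')
  have h2 : HasDerivAt (fun x : ℝ => 1 / (2 * x ^ 2)) (-(1 / x ^ 3)) x := by
    refine ((hasDerivAt_const x (1 : ℝ)).div ((hasDerivAt_pow 2 x).const_mul 2)
      (by positivity)).congr_deriv ?_
    push_cast
    field_simp
    norm_num
  refine (h1.mul h2.exp).congr_deriv ?_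
  rw [kerS, kerR, Real.rpow_sub_one hx.ne']
  ring

lemma hasDerivAt_kerR (hx : 0 < x) :
    HasDerivAt (kerR α) (-(2 * α - 1) / x ^ 2 + 3 / x ^ 4) x := by
  refine (((hasDerivAt_const x (2 * α - 1)).div (hasDerivAt_id x) hx.ne').sub
    ((hasDerivAt_const x (1 : ℝ)).div (hasDerivAt_pow 3 x) (by positivity))).congr_deriv ?_
  simp only [id]
  push_cast
  field_simp
  ring

lemma translPos_hasDerivAt (hα : α < 1 / 2) (hf : InE f) (hx : 0 < x) (hy : 0 < y)
    (hne : x ≠ y) :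
    HasDerivAt (fun x => translPos α f y x) ((2 * Real.pi) ^ (-(1 : ℝ) / 2) * kerS α y *
      (kerS α x * (kerR α x * kerInt α f (ker0 α y x) + kerInt α f (ker1 α y x)))) x := by
  have h := (((hasDerivAt_kerS (α := α) hx).mul (hasDerivAt_kerInt hα hf hx hy hne).2).const_mul
    ((2 * Real.pi) ^ (-(1 : ℝ) / 2) * kerS α y)).congr_deriv (g' := (2 * Real.pi) ^ (-(1 : ℝ) / 2)
      * kerS α y * (kerS α x * (kerR α x * kerInt α f (ker0 α y x) + kerInt α f (ker1 α y x))))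
    (by ring)
  refine h.congr_of_eventuallyEq ?_
  filter_upwards [lt_mem_nhds hx] with t ht
  rw [translPos_eq hα ht hy, Pi.mul_apply]
  ring

lemma eventually_pos_ne (hx : 0 < x) (hne : x ≠ y) : ∀ᶠ t in 𝓝 x, 0 < t ∧ t ≠ y :=
  (lt_mem_nhds hx).and (eventually_ne_nhds hne)

lemma translPos_deriv_hasDerivAt (hα : α < 1 / 2) (hf : InE f) (hx : 0 < x) (hy : 0 < y)
    (hne : x ≠ y) :
    HasDerivAt (deriv fun x => translPos α f y x) ((2 * Real.pi) ^ (-(1 : ℝ) / 2) * kerS α y *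
      (kerS α x * ((kerR α x ^ 2 + (-(2 * α - 1) / x ^ 2 + 3 / x ^ 4)) * kerInt α f (ker0 α y x)
        + 2 * kerR α x * kerInt α f (ker1 α y x) + kerInt α f (ker2 α y x)))) x := by
  have h := (((hasDerivAt_kerS (α := α) hx).mul
    (((hasDerivAt_kerR (α := α) hx).mul (hasDerivAt_kerInt hα hf hx hy hne).2).add
      (hasDerivAt_kerInt' hα hf hx hy hne).2.2)).const_mul
    ((2 * Real.pi) ^ (-(1 : ℝ) / 2) * kerS α y))
  refine (h.congr_of_eventuallyEq ?_).congr_deriv ?_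
  · filter_upwards [eventually_pos_ne hx hne] with t ht
    exact (translPos_hasDerivAt hα hf ht.1 hy ht.2).deriv
  · simp only [Pi.add_apply, Pi.mul_apply]
    ring

lemma c2At_translPos (hα : α < 1 / 2) (hf : InE f) (hx : 0 < x) (hy : 0 < y) (hne : x ≠ y) :
    C2At (fun x => translPos α f y x) x :=
  ⟨(eventually_pos_ne hx hne).mono fun _ ht =>
      (translPos_hasDerivAt hα hf ht.1 hy ht.2).differentiableAt,
    (translPos_deriv_hasDerivAt hα hf hx hy hne).differentiableAt⟩

/-- The kernel of `L` applied to the translation, up to the prefactor. -/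
def kerL (α y x ξ : ℝ) : ℝ :=
  x ^ 2 * ker2 α y x ξ + (x - 1 / x) * ker1 α y x ξ + (2 * α + 1) / x ^ 2 * ker0 α y x ξ

lemma kerL_comm (hx : 0 < x) (hy : 0 < y) {ξ : ℝ} (hξ : 0 < ξ) :
    kerL α y x ξ = kerL α x y ξ := by
  rw [kerL, kerL, ker2, ker2, ker1, ker1, ker0, ker0, kerArg_comm y x, kerG'']
  have e : kerArg x y ξ * (2 * x * y * ξ) = x ^ 2 + y ^ 2 + ξ ^ 2 := by
    rw [kerArg]; field_simp
  generalize kerG α (kerArg x y ξ) = g0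
  generalize kerG' α (kerArg x y ξ) = g1
  simp only [kerArg, kerArg', kerArg'']
  field_simp
  ring

lemma Lop_translPos (hα : α < 1 / 2) (hf : InE f) (hx : 0 < x) (hy : 0 < y) (hne : x ≠ y) :
    Lop α (fun x => translPos α f y x) x = -(1 / 4) * ((2 * Real.pi) ^ (-(1 : ℝ) / 2) * kerS α x
      * kerS α y * (kerInt α f (kerL α y x) - (1 - 2 * α) ^ 2 * kerInt α f (ker0 α y x))) := by
  obtain ⟨i0, -⟩ := hasDerivAt_kerInt hα hf hx hy hne
  obtain ⟨i1, i2, -⟩ := hasDerivAt_kerInt' hα hf hx hy hne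
  have e : kerInt α f (kerL α y x) = x ^ 2 * kerInt α f (ker2 α y x)
      + (x - 1 / x) * kerInt α f (ker1 α y x)
      + (2 * α + 1) / x ^ 2 * kerInt α f (ker0 α y x) := by
    simp only [kerInt]
    have a1 := integral_add (i2.const_mul (x ^ 2)) (i1.const_mul (x - 1 / x))
    have a2 := integral_add ((i2.const_mul (x ^ 2)).add (i1.const_mul (x - 1 / x)))
      (i0.const_mul ((2 * α + 1) / x ^ 2))
    simp only [Pi.add_apply] at a1 a2
    rw [← integral_const_mul, ← integral_const_mul, ← integral_const_mul, ← a1, ← a2]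
    refine integral_congr_ae (ae_of_all _ fun ξ => ?_)
    simp only [kerL]
    ring
  rw [Lop, (translPos_deriv_hasDerivAt hα hf hx hy hne).deriv,
    (translPos_hasDerivAt hα hf hx hy hne).deriv, e, kerR]
  field_simp
  ring

/-- The translation `T^y f(x)` solves `L_x u = L_y u` off the diagonal. -/
lemma Lop_translPos_comm (hα : α < 1 / 2) (hf : InE f) (hx : 0 < x) (hy : 0 < y) (hne : x ≠ y) :
    Lop α (fun x => translPos α f y x) x = Lop α (fun y => translPos α f y x) y := by
  have e : (fun t => translPos α f t x) =ᶠ[𝓝 y] fun t => translPos α f x t := by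
    filter_upwards [lt_mem_nhds hy] with t ht using translPos_comm hα hx ht
  have e' : Lop α (fun y => translPos α f y x) y = Lop α (fun t => translPos α f x t) y := by
    rw [Lop, Lop, e.deriv.deriv_eq, e.deriv_eq]
  have e1 : kerInt α f (kerL α y x) = kerInt α f (kerL α x y) :=
    setIntegral_congr_fun measurableSet_Ioi fun ξ hξ => by
      simp only [kerL_comm hx hy (ξ := ξ) hξ]
  have e2 : kerInt α f (ker0 α y x) = kerInt α f (ker0 α x y) := by
    simp only [kerInt, ker0_comm (x := x) (y := y)]
  rw [e', Lop_translPos hα hf hx hy hne, Lop_translPos hα hf hy hx hne.symm, e1, e2]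
  ring

end

section
variable {α x y τ ξ : ℝ} {f : ℝ → ℝ}

/-- The translation integrand at `ξ = x + y τ`, in rescaled form. -/
def scaledKer (α : ℝ) (f : ℝ → ℝ) (x y τ ξ : ℝ) : ℝ :=
  f ξ * ((2 * Real.pi) ^ (-(1 : ℝ) / 2) * x⁻¹ * ξ ^ (-(4 * α)) *
    ((x ^ 2 + y ^ 2 + ξ ^ 2) / 2) ^ (2 * α) *
    (kerArg x y ξ ^ (-(2 * α)) * hermiteFn α (kerArg x y ξ)) *
    Real.exp (1 / (2 * x ^ 2) - 1 / (2 * ξ ^ 2)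
      - (τ * (ξ + x) + y) ^ 2 / (8 * x ^ 2 * ξ ^ 2)))

lemma scaledKer_eq (hx : 0 < x) (hy : 0 < y) (hξ : 0 < ξ) (h : ξ = x + y * τ) :
    y * ((2 * Real.pi) ^ (-(1 : ℝ) / 2) * kerS α x * kerS α y *
      (f ξ * ξ ^ (-(2 * α)) * ker0 α y x ξ)) = scaledKer α f x y τ ξ := by
  have hz := kerArg_pos hx hy hξ
  have hS : 0 < (x ^ 2 + y ^ 2 + ξ ^ 2) / 2 := by positivity
  have e1 : (x ^ 2 + y ^ 2 + ξ ^ 2) / 2 = kerArg x y ξ * (x * (y * ξ)) := by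
    rw [kerArg]; field_simp
  have e2 : y * (τ * (ξ + x) + y) = ξ ^ 2 - x ^ 2 + y ^ 2 := by rw [h]; ring
  have e3 : Real.exp (1 / (2 * x ^ 2) - 1 / (2 * ξ ^ 2)
      - (τ * (ξ + x) + y) ^ 2 / (8 * x ^ 2 * ξ ^ 2))
      = Real.exp (1 / (2 * x ^ 2)) * Real.exp (1 / (2 * y ^ 2))
        * Real.exp (-kerArg x y ξ ^ 2 / 2) := by
    rw [← Real.exp_add, ← Real.exp_add]
    congr 1
    have e4 : (τ * (ξ + x) + y) ^ 2 / (8 * x ^ 2 * ξ ^ 2)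
        = (ξ ^ 2 - x ^ 2 + y ^ 2) ^ 2 / (8 * x ^ 2 * y ^ 2 * ξ ^ 2) := by
      rw [← e2]; field_simp
    rw [e4, kerArg]
    field_simp
    ring
  have hp : ∀ {t : ℝ}, 0 < t → t ^ (2 * α) = t * t ^ (2 * α - 1) := fun {t} ht => by
    rw [Real.rpow_sub_one ht.ne']; field_simp
  have hp' : ξ ^ (-(4 * α)) = ξ ^ (-(2 * α)) * ξ ^ (-(2 * α)) := by
    rw [← Real.rpow_add hξ]; congr 1; ring
  have hn : ∀ {t : ℝ}, 0 < t → t ^ (2 * α) * t ^ (-(2 * α)) = 1 := fun {t} ht => by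
    rw [← Real.rpow_add ht, add_neg_cancel, Real.rpow_zero]
  rw [scaledKer, e3, e1, Real.mul_rpow hz.le (by positivity), Real.mul_rpow hx.le (by positivity),
    Real.mul_rpow hy.le hξ.le, hp', ker0, kerG, kerS, kerS, hp hx, hp hy]
  have a1 := hn hξ
  have a2 := hn hz
  generalize kerArg x y ξ ^ (2 * α) = z1 at *
  generalize kerArg x y ξ ^ (-(2 * α)) = z2 at *
  generalize ξ ^ (2 * α) = x1 at *
  generalize ξ ^ (-(2 * α)) = x2 at *
  field_simp
  linear_combination (-(f ξ * x2 * hermiteFn α (kerArg x y ξ))) * (x1 * x2 * a2 + a1)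

lemma inv_le_kerArg (hx : 0 < x) (hy : 0 < y) (hξ : 0 < ξ) : y⁻¹ ≤ kerArg x y ξ := by
  rw [kerArg, inv_eq_one_div, div_le_div_iff₀ hy (by positivity)]
  nlinarith [mul_nonneg hy.le (sq_nonneg (x - ξ)), pow_pos hy 3]

/-- The rescaled translation integrand on the whole line. -/
def scaledInt (α : ℝ) (f : ℝ → ℝ) (x y τ : ℝ) : ℝ :=
  if 0 < x + y * τ then scaledKer α f x y τ (x + y * τ) else 0

lemma translPos_eq_integral_scaledInt (hα : α < 1 / 2) (hx : 0 < x) (hy : 0 < y) :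
    translPos α f y x = ∫ τ, scaledInt α f x y τ := by
  set Φ : ℝ → ℝ := (Ioi 0).indicator fun ξ => (2 * Real.pi) ^ (-(1 : ℝ) / 2) * kerS α x
    * kerS α y * (f ξ * ξ ^ (-(2 * α)) * ker0 α y x ξ) with hΦ
  have e1 : translPos α f y x = ∫ ξ, Φ ξ := by
    rw [hΦ, integral_indicator measurableSet_Ioi]
    exact setIntegral_congr_fun measurableSet_Ioi fun ξ hξ =>
      translPos_integrand_eq hα hx hy hξ _
  have e2 : ∫ τ, Φ (x + y * τ) = y⁻¹ * ∫ ξ, Φ ξ := by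
    rw [Measure.integral_comp_mul_left (fun ξ => Φ (x + ξ)), abs_of_pos (inv_pos.2 hy),
      integral_add_left_eq_self, smul_eq_mul]
  rw [e1, show ∫ ξ, Φ ξ = y * (y⁻¹ * ∫ ξ, Φ ξ) by field_simp, ← e2, ← integral_const_mul]
  refine integral_congr_ae (ae_of_all _ fun τ => ?_)
  by_cases h : 0 < x + y * τ
  · simp only [scaledInt, if_pos h, hΦ, indicator_of_mem (mem_Ioi.2 h)]
    exact scaledKer_eq hx hy h rfl
  · simp only [scaledInt, if_neg h, hΦ, indicator_of_notMem (s := Ioi (0 : ℝ)) (mt mem_Ioi.1 h),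
      mul_zero]

lemma measurable_scaledInt (hα : α < 1 / 2) (hf : Measurable f) (hx : 0 < x) (hy : 0 < y) :
    Measurable (scaledInt α f x y) := by
  have h1 : Measurable ((Ioi 0).piecewise (ker0 α y x) 0) :=
    (continuousOn_ker0 hα hx hy).measurable_piecewise continuousOn_const measurableSet_Ioi
  have h2 : scaledInt α f x y = fun τ => y * ((2 * Real.pi) ^ (-(1 : ℝ) / 2) * kerS α x
      * kerS α y * (f (x + y * τ) * (x + y * τ) ^ (-(2 * α))
        * (Ioi 0).piecewise (ker0 α y x) 0 (x + y * τ))) := by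
    ext τ
    by_cases h : 0 < x + y * τ
    · rw [scaledInt, if_pos h, piecewise_eq_of_mem _ _ _ (mem_Ioi.2 h), scaledKer_eq hx hy h rfl]
    · rw [scaledInt, if_neg h, piecewise_eq_of_notMem _ _ _ (mt mem_Ioi.1 h)]
      simp
  have h3 : Measurable fun τ : ℝ => x + y * τ := by fun_prop
  rw [h2]
  exact ((((hf.comp h3).mul (h3.pow_const _)).mul (h1.comp h3)).const_mul _).const_mul _

lemma tendsto_scaledInt (hα : α < 1 / 2) (hx : 0 < x) (hc : ContinuousAt f x) (τ : ℝ) :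
    Tendsto (fun y => scaledInt α f x y τ) (𝓝[>] 0)
      (𝓝 (f x * ((2 * Real.pi) ^ (-(1 : ℝ) / 2) * x⁻¹ * Real.exp (-(1 / (2 * x ^ 2)) * τ ^ 2)))) := by
  have hξ : Tendsto (fun y : ℝ => x + y * τ) (𝓝[>] 0) (𝓝 x) := by
    have : Continuous fun y : ℝ => x + y * τ := by fun_prop
    simpa using (this.tendsto 0).mono_left nhdsWithin_le_nhds
  have hy : Tendsto (fun y : ℝ => y) (𝓝[>] 0) (𝓝 0) := nhdsWithin_le_nhds
  have hpos : ∀ᶠ y in 𝓝[>] (0 : ℝ), 0 < x + y * τ := hξ.eventually (lt_mem_nhds hx)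
  have hz : Tendsto (fun y : ℝ => kerArg x y (x + y * τ)) (𝓝[>] 0) atTop := by
    refine tendsto_atTop_mono' _ ?_ tendsto_inv_nhdsGT_zero
    filter_upwards [hpos, self_mem_nhdsWithin] with y h1 h2 using inv_le_kerArg hx h2 h1
  have h1 := (tendsto_rpow_neg_mul_hermiteFn hα).comp hz
  have h2 : Tendsto (fun y : ℝ => (x + y * τ) ^ (-(4 * α))) (𝓝[>] 0) (𝓝 (x ^ (-(4 * α)))) :=
    hξ.rpow_const (Or.inl hx.ne')
  have h3 : Tendsto (fun y : ℝ => ((x ^ 2 + y ^ 2 + (x + y * τ) ^ 2) / 2) ^ (2 * α)) (𝓝[>] 0)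
      (𝓝 (((x ^ 2 + 0 ^ 2 + x ^ 2) / 2) ^ (2 * α))) :=
    (((tendsto_const_nhds.add (hy.pow 2)).add (hξ.pow 2)).div_const 2).rpow_const
      (Or.inl (by positivity))
  have h4 : Tendsto (fun y : ℝ => Real.exp (1 / (2 * x ^ 2) - 1 / (2 * (x + y * τ) ^ 2)
      - (τ * ((x + y * τ) + x) + y) ^ 2 / (8 * x ^ 2 * (x + y * τ) ^ 2))) (𝓝[>] 0)
      (𝓝 (Real.exp (1 / (2 * x ^ 2) - 1 / (2 * x ^ 2)
      - (τ * (x + x) + 0) ^ 2 / (8 * x ^ 2 * x ^ 2)))) := by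
    refine (Real.continuous_exp.tendsto _).comp ((tendsto_const_nhds.sub
      (tendsto_const_nhds.div ((hξ.pow 2).const_mul 2) (by positivity))).sub
      (Tendsto.div ?_ ((hξ.pow 2).const_mul _) (by positivity)))
    exact (((hξ.add_const x).const_mul τ).add hy).pow 2
  have h5 := (hc.tendsto.comp hξ).mul ((((h2.const_mul
    ((2 * Real.pi) ^ (-(1 : ℝ) / 2) * x⁻¹)).mul h3).mul h1).mul h4)
  have e1 : x ^ (-(4 * α)) * ((x ^ 2 + 0 ^ 2 + x ^ 2) / 2) ^ (2 * α) = 1 := by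
    rw [show (x ^ 2 + 0 ^ 2 + x ^ 2) / 2 = x ^ (2 : ℝ) by rw [Real.rpow_two]; ring,
      ← Real.rpow_mul hx.le, ← Real.rpow_add hx, show -(4 * α) + 2 * (2 * α) = 0 by ring,
      Real.rpow_zero]
  have e2 : 1 / (2 * x ^ 2) - 1 / (2 * x ^ 2) - (τ * (x + x) + 0) ^ 2 / (8 * x ^ 2 * x ^ 2)
      = -(1 / (2 * x ^ 2)) * τ ^ 2 := by field_simp; ring
  rw [e2, mul_one, mul_assoc _ (x ^ (-(4 * α))), e1, mul_one] at h5
  refine h5.congr' ?_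
  filter_upwards [hpos] with y h
  rw [scaledInt, if_pos h, scaledKer]
  rfl

lemma scaled_exponent_le {ε : ℝ} (hx : 0 < x) (hy : 0 < y) (hy1 : y ≤ 1) (hyx : y ≤ x / 2)
    (hξ : 0 < ξ) (h : ξ = x + y * τ) (hε : 0 < ε) (hε1 : ε ≤ 1 / 32)
    (hε2 : ε ≤ 1 / (64 * x ^ 2)) :
    ε * ((ξ ^ 2)⁻¹ + ξ ^ 2) - (τ * (ξ + x) + y) ^ 2 / (8 * x ^ 2 * ξ ^ 2)
      ≤ 1 / (4 * x ^ 2) + 2 * ε * x ^ 2 - 1 / (32 * x ^ 2) * τ ^ 2 := by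
  have a1 : (τ ^ 2 * (ξ + x) ^ 2 / 2 - y ^ 2) / (8 * x ^ 2 * ξ ^ 2)
      ≤ (τ * (ξ + x) + y) ^ 2 / (8 * x ^ 2 * ξ ^ 2) := by
    gcongr
    nlinarith [sq_nonneg (τ * (ξ + x) + 2 * y)]
  have a2 : τ ^ 2 / (16 * x ^ 2) + τ ^ 2 * (ξ ^ 2)⁻¹ / 16 - y ^ 2 / (8 * x ^ 2) * (ξ ^ 2)⁻¹
      ≤ (τ ^ 2 * (ξ + x) ^ 2 / 2 - y ^ 2) / (8 * x ^ 2 * ξ ^ 2) := by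
    have : (τ ^ 2 * (ξ + x) ^ 2 / 2 - y ^ 2) / (8 * x ^ 2 * ξ ^ 2)
        = τ ^ 2 / (16 * x ^ 2) + τ ^ 2 * (ξ ^ 2)⁻¹ / 16 - y ^ 2 / (8 * x ^ 2) * (ξ ^ 2)⁻¹
          + τ ^ 2 / (8 * x * ξ) := by
      field_simp
      ring
    rw [this]
    have : 0 ≤ τ ^ 2 / (8 * x * ξ) := by positivity
    linarith
  have a3 : y ^ 2 / (8 * x ^ 2) ≤ 1 / 32 := by
    rw [div_le_div_iff₀ (by positivity) (by norm_num)]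
    nlinarith
  have hi : 0 < (ξ ^ 2)⁻¹ := by positivity
  have a4 : (ξ ^ 2)⁻¹ ≤ 4 / x ^ 2 + τ ^ 2 * (ξ ^ 2)⁻¹ := by
    rcases le_total (x / 2) ξ with h1 | h1
    · have : (ξ ^ 2)⁻¹ ≤ 4 / x ^ 2 := by
        rw [inv_eq_one_div, div_le_div_iff₀ (by positivity) (by positivity)]
        nlinarith
      have : 0 ≤ τ ^ 2 * (ξ ^ 2)⁻¹ := by positivity
      linarith
    · have h2 : 1 ≤ τ ^ 2 := by
        have : 1 ≤ -τ := by
          by_contra! h3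
          nlinarith
        nlinarith
      have : 0 ≤ 4 / x ^ 2 := by positivity
      nlinarith
  have a5 : ξ ^ 2 ≤ 2 * x ^ 2 + 2 * τ ^ 2 := by
    have : y ^ 2 * τ ^ 2 ≤ 1 * τ ^ 2 := by gcongr; exact pow_le_one₀ hy.le hy1
    rw [h]
    nlinarith [sq_nonneg (x - y * τ)]
  have a6 : 2 * ε * τ ^ 2 ≤ 1 / (32 * x ^ 2) * τ ^ 2 := by
    gcongr
    calc 2 * ε ≤ 2 * (1 / (64 * x ^ 2)) := by linarith
      _ = _ := by field_simp; norm_num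
  have a7 : (ε + y ^ 2 / (8 * x ^ 2)) * (ξ ^ 2)⁻¹ ≤ 1 / 16 * (4 / x ^ 2 + τ ^ 2 * (ξ ^ 2)⁻¹) := by
    calc _ ≤ 1 / 16 * (ξ ^ 2)⁻¹ := by gcongr; linarith
      _ ≤ _ := by gcongr
  have a8 : ε * ξ ^ 2 ≤ ε * (2 * x ^ 2 + 2 * τ ^ 2) := by gcongr
  have a9 : τ ^ 2 / (16 * x ^ 2) = 2 * (1 / (32 * x ^ 2) * τ ^ 2) := by field_simp; ring
  have a10 : 1 / 16 * (4 / x ^ 2) = 1 / (4 * x ^ 2) := by field_simp; norm_num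
  linarith

lemma exists_rpow_average_le (hα : α < 1 / 2) (hx : 0 < x) :
    ∃ M : ℝ, 0 ≤ M ∧ ∀ y ξ : ℝ, 0 < y → y ≤ 1 → 0 < ξ →
      ((x ^ 2 + y ^ 2 + ξ ^ 2) / 2) ^ (2 * α) ≤ M * (ξ + ξ⁻¹) ^ 2 := by
  refine ⟨2 + x ^ 2 + (x ^ 2 / 2) ^ (2 * α), by positivity, fun y ξ hy hy1 hξ => ?_⟩
  have hi : 0 < ξ⁻¹ := inv_pos.2 hξ
  have h1 : ξ ^ 2 + 2 ≤ (ξ + ξ⁻¹) ^ 2 := by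
    have : ξ * ξ⁻¹ = 1 := mul_inv_cancel₀ hξ.ne'
    nlinarith [sq_nonneg ξ⁻¹]
  have h0 : 0 ≤ (x ^ 2 / 2) ^ (2 * α) := by positivity
  have hS : 0 < (x ^ 2 + y ^ 2 + ξ ^ 2) / 2 := by positivity
  rcases le_total 0 α with h | h
  · have h2 : ((x ^ 2 + y ^ 2 + ξ ^ 2) / 2) ^ (2 * α) ≤ 1 + (x ^ 2 + y ^ 2 + ξ ^ 2) / 2 := by
      rcases le_total ((x ^ 2 + y ^ 2 + ξ ^ 2) / 2) 1 with h3 | h3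
      · linarith [Real.rpow_le_one hS.le h3 (by linarith : 0 ≤ 2 * α)]
      · have := Real.rpow_le_rpow_of_exponent_le h3 (by linarith : 2 * α ≤ 1)
        rw [Real.rpow_one] at this
        linarith
    have h4 : y ^ 2 ≤ 1 := pow_le_one₀ hy.le hy1
    nlinarith [mul_nonneg h0 (sq_nonneg (ξ + ξ⁻¹)), mul_nonneg (sq_nonneg x) (sq_nonneg ξ),
      sq_nonneg x, sq_nonneg ξ]
  · have h2 : ((x ^ 2 + y ^ 2 + ξ ^ 2) / 2) ^ (2 * α) ≤ (x ^ 2 / 2) ^ (2 * α) :=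
      Real.rpow_le_rpow_of_nonpos (by positivity)
        (by nlinarith [sq_nonneg y, sq_nonneg ξ]) (by linarith)
    nlinarith [mul_nonneg h0 (sq_nonneg ξ), sq_nonneg x, sq_nonneg ξ,
      mul_nonneg (sq_nonneg x) (sq_nonneg ξ)]

lemma exists_scaledInt_bound (hα : α < 1 / 2) (hf : InE f) (hx : 0 < x) :
    ∃ K : ℝ, ∀ y, 0 < y → y ≤ 1 → y ≤ x / 2 → ∀ τ,
      |scaledInt α f x y τ| ≤ K * Real.exp (-(1 / (32 * x ^ 2)) * τ ^ 2) := by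
  obtain ⟨-, b₁, b₂, β, hb₁, hb₂, hβ0, hβ, hfb⟩ := hf
  set ε := min (1 / 32) (1 / (64 * x ^ 2)) with hε
  have hε0 : 0 < ε := lt_min (by norm_num) (by positivity)
  obtain ⟨C, hC, hgr⟩ := exists_growth_bound (-(4 * α)) b₂ β ε 2 hb₂ hβ0 hβ hε0
  obtain ⟨M, hM, hS⟩ := exists_rpow_average_le hα hx
  obtain ⟨D, hD, hk⟩ := exists_abs_rpow_neg_mul_hermiteFn_le hα
  set c := (2 * Real.pi) ^ (-(1 : ℝ) / 2) * x⁻¹ with hc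
  have c0 : 0 ≤ c := by positivity
  set E := Real.exp (1 / (2 * x ^ 2)) * Real.exp (1 / (4 * x ^ 2) + 2 * ε * x ^ 2) with hE
  refine ⟨b₁ * c * M * D * C * E, fun y hy hy1 hyx τ => ?_⟩
  by_cases h : 0 < x + y * τ
  swap
  · rw [scaledInt, if_neg h, abs_zero]
    positivity
  rw [scaledInt, if_pos h]
  have hexp := scaled_exponent_le hx hy hy1 hyx h rfl hε0 (min_le_left _ _) (min_le_right _ _)
  generalize hξ : x + y * τ = ξ at *
  have hz : 1 ≤ kerArg x y ξ :=
    ((one_le_inv₀ hy).2 hy1).trans (inv_le_kerArg hx hy h)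
  have hi : 0 < ξ⁻¹ := inv_pos.2 h
  have k1 := hk _ hz
  have k2 := hS y ξ hy hy1 h
  have k3 := hfb ξ h
  have k4 := hgr ξ h
  have p1 : 0 ≤ ((x ^ 2 + y ^ 2 + ξ ^ 2) / 2) ^ (2 * α) := by positivity
  have p2 : 0 ≤ ξ ^ (-(4 * α)) := by positivity
  rw [scaledKer]
  simp only [abs_mul, Real.abs_exp, abs_of_nonneg c0, abs_of_nonneg p1, abs_of_nonneg p2, ← hc]
  rw [abs_mul] at k1
  generalize hQ : (τ * (ξ + x) + y) ^ 2 / (8 * x ^ 2 * ξ ^ 2) = Q at *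
  calc _ ≤ b₁ * Real.exp (1 / (2 * ξ ^ 2) + b₂ * (ξ ^ (-β) + ξ ^ β)) *
        (c * ξ ^ (-(4 * α)) * (M * (ξ + ξ⁻¹) ^ 2) * D *
          Real.exp (1 / (2 * x ^ 2) - 1 / (2 * ξ ^ 2) - Q)) := by
        gcongr
    _ = b₁ * c * M * D * Real.exp (1 / (2 * x ^ 2)) *
        (ξ ^ (-(4 * α)) * (ξ + ξ⁻¹) ^ 2 * Real.exp (b₂ * (ξ ^ (-β) + ξ ^ β)))
          * Real.exp (-Q) := by
        rw [sub_eq_add_neg, sub_eq_add_neg, Real.exp_add, Real.exp_add, Real.exp_add,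
          Real.exp_neg (1 / (2 * ξ ^ 2))]
        have := Real.exp_ne_zero (1 / (2 * ξ ^ 2))
        field_simp
    _ ≤ b₁ * c * M * D * Real.exp (1 / (2 * x ^ 2)) *
        (C * Real.exp (ε * ((ξ ^ 2)⁻¹ + ξ ^ 2))) * Real.exp (-Q) :=
        mul_le_mul_of_nonneg_right (mul_le_mul_of_nonneg_left k4 (by positivity))
          (Real.exp_pos _).le
    _ = b₁ * c * M * D * C * Real.exp (1 / (2 * x ^ 2)) *
        Real.exp (ε * ((ξ ^ 2)⁻¹ + ξ ^ 2) - Q) := by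
        rw [sub_eq_add_neg, Real.exp_add]
        ring
    _ ≤ b₁ * c * M * D * C * Real.exp (1 / (2 * x ^ 2)) *
        Real.exp (1 / (4 * x ^ 2) + 2 * ε * x ^ 2 - 1 / (32 * x ^ 2) * τ ^ 2) :=
        mul_le_mul_of_nonneg_left (Real.exp_le_exp.2 hexp) (by positivity)
    _ = _ := by
        rw [hE, sub_eq_add_neg, Real.exp_add, neg_mul]
        ring

/-- The translation operators form an approximate identity as `y → 0`. -/
lemma tendsto_translPos (hα : α < 1 / 2) (hf : InE f) (hx : 0 < x) (hc : ContinuousAt f x) :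
    Tendsto (fun y => translPos α f y x) (𝓝[>] 0) (𝓝 (f x)) := by
  obtain ⟨K, hK⟩ := exists_scaledInt_bound hα hf hx
  have hsmall : ∀ᶠ y in 𝓝[>] (0 : ℝ), 0 < y ∧ y ≤ 1 ∧ y ≤ x / 2 := by
    filter_upwards [self_mem_nhdsWithin, Ioc_mem_nhdsGT one_pos,
      Ioc_mem_nhdsGT (half_pos hx)] with y h1 h2 h3 using ⟨h1, h2.2, h3.2⟩
  have hlim : Tendsto (fun y => ∫ τ, scaledInt α f x y τ) (𝓝[>] 0) (𝓝 (∫ τ, f x *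
      ((2 * Real.pi) ^ (-(1 : ℝ) / 2) * x⁻¹ * Real.exp (-(1 / (2 * x ^ 2)) * τ ^ 2)))) := by
    refine tendsto_integral_filter_of_dominated_convergence
      (fun τ => K * Real.exp (-(1 / (32 * x ^ 2)) * τ ^ 2)) ?_ ?_ ?_ ?_
    · filter_upwards [self_mem_nhdsWithin] with y hy
      exact (measurable_scaledInt hα hf.1 hx hy).aestronglyMeasurable
    · filter_upwards [hsmall] with y hy
      exact ae_of_all _ fun τ => hK y hy.1 hy.2.1 hy.2.2 τ
    · exact (integrable_exp_neg_mul_sq (by positivity)).const_mul K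
    · exact ae_of_all _ fun τ => tendsto_scaledInt hα hx hc τ
  have hval : ∫ τ, f x * ((2 * Real.pi) ^ (-(1 : ℝ) / 2) * x⁻¹
      * Real.exp (-(1 / (2 * x ^ 2)) * τ ^ 2)) = f x := by
    rw [integral_const_mul, integral_const_mul, integral_gaussian,
      show Real.pi / (1 / (2 * x ^ 2)) = (2 * Real.pi) * x ^ 2 by field_simp,
      Real.sqrt_mul (by positivity), Real.sqrt_sq hx.le, Real.sqrt_eq_rpow, neg_div,
      Real.rpow_neg (by positivity)]
    have : (2 * Real.pi) ^ ((1 : ℝ) / 2) ≠ 0 := (Real.rpow_pos_of_pos (by positivity) _).ne'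
    field_simp
  rw [hval] at hlim
  refine hlim.congr' ?_
  filter_upwards [self_mem_nhdsWithin] with y hy
  rw [translPos_eq_integral_scaledInt hα hx hy]

end

/-- `f` is twice differentiable at `x` and `L f(x) = v`. -/
def HasLop (α : ℝ) (f : ℝ → ℝ) (x v : ℝ) : Prop := C2At f x ∧ Lop α f x = v

section
variable {α x v w : ℝ} {f g : ℝ → ℝ}

lemma HasLop.congr (h : HasLop α f x v) (e : g =ᶠ[𝓝 x] f) : HasLop α g x v := by
  refine ⟨⟨?_, h.1.2.congr_of_eventuallyEq e.deriv⟩, ?_⟩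
  · filter_upwards [h.1.1, e.eventually_nhds] with t h1 h2 using h1.congr_of_eventuallyEq h2
  · rw [← h.2, Lop, Lop, e.deriv.deriv_eq, e.deriv_eq]

lemma HasLop.add (hf : HasLop α f x v) (hg : HasLop α g x w) :
    HasLop α (fun t => f t + g t) x (v + w) := by
  have e : deriv (fun t => f t + g t) =ᶠ[𝓝 x] fun t => deriv f t + deriv g t := by
    filter_upwards [hf.1.1, hg.1.1] with t h1 h2 using deriv_fun_add h1 h2
  refine ⟨⟨?_, (hf.1.2.add hg.1.2).congr_of_eventuallyEq e⟩, ?_⟩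
  · filter_upwards [hf.1.1, hg.1.1] with t h1 h2 using h1.add h2
  · rw [← hf.2, ← hg.2, Lop, Lop, Lop, e.deriv_eq, e.eq_of_nhds, deriv_fun_add hf.1.2 hg.1.2]
    ring

lemma HasLop.const_mul (c : ℝ) (hf : HasLop α f x v) :
    HasLop α (fun t => c * f t) x (c * v) := by
  have e : deriv (fun t => c * f t) =ᶠ[𝓝 x] fun t => c * deriv f t := by
    filter_upwards [hf.1.1] with t h1 using deriv_const_mul c h1
  refine ⟨⟨?_, (hf.1.2.const_mul c).congr_of_eventuallyEq e⟩, ?_⟩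
  · filter_upwards [hf.1.1] with t h1 using h1.const_mul c
  · rw [← hf.2, Lop, Lop, e.deriv_eq, e.eq_of_nhds, deriv_const_mul c hf.1.2]
    ring

lemma hasLop_const (α x c : ℝ) : HasLop α (fun _ => c) x 0 := by
  have e : deriv (fun _ : ℝ => c) = fun _ => 0 := funext fun t => deriv_const t c
  refine ⟨⟨Eventually.of_forall fun t => differentiableAt_const c, ?_⟩, ?_⟩
  · rw [e]; exact differentiableAt_const 0
  · rw [Lop, e, deriv_const]; ring

lemma hasLop_sum {ι : Type*} (s : Finset ι) (F : ι → ℝ → ℝ) (V : ι → ℝ)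
    (h : ∀ i ∈ s, HasLop α (F i) x (V i)) :
    HasLop α (fun t => ∑ i ∈ s, F i t) x (∑ i ∈ s, V i) := by
  classical
  induction s using Finset.induction_on with
  | empty => simpa using hasLop_const α x 0
  | insert a s ha ih =>
    simp only [Finset.sum_insert ha]
    exact (h a (Finset.mem_insert_self a s)).add
      (ih fun i hi => h i (Finset.mem_insert_of_mem hi))

lemma C2At.hasLop (h : C2At f x) (α : ℝ) : HasLop α f x (Lop α f x) := ⟨h, rfl⟩

lemma C2At.continuousAt (h : C2At f x) : ContinuousAt f x :=
  h.1.self_of_nhds.continuousAt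

end

/-- Binomial convolution of sequences. -/
def binConv (a b : ℕ → ℝ) (k : ℕ) : ℝ :=
  ∑ j ∈ Finset.range (k + 1), (k.choose j : ℝ) * a j * b (k - j)

/-- The exponential generating function of a sequence. -/
def egf (a : ℕ → ℝ) : PowerSeries ℝ := PowerSeries.mk fun i => a i / i.factorial

lemma egf_injective : Function.Injective egf := fun a b h => by
  ext i
  have := congrArg (PowerSeries.coeff i) h
  simp only [egf, PowerSeries.coeff_mk] at this
  have h0 : (i.factorial : ℝ) ≠ 0 := Nat.cast_ne_zero.2 i.factorial_ne_zero
  field_simp at this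
  exact this

lemma egf_binConv (a b : ℕ → ℝ) : egf (binConv a b) = egf a * egf b := by
  ext k
  rw [PowerSeries.coeff_mul, Finset.Nat.sum_antidiagonal_eq_sum_range_succ_mk]
  simp only [egf, PowerSeries.coeff_mk, binConv]
  rw [Finset.sum_div]
  refine Finset.sum_congr rfl fun j hj => ?_
  rw [Nat.cast_choose ℝ (Nat.lt_succ_iff.1 (Finset.mem_range.1 hj))]
  have h0 : (k.factorial : ℝ) ≠ 0 := Nat.cast_ne_zero.2 k.factorial_ne_zero
  field_simp

lemma binConv_left_comm (l a b : ℕ → ℝ) :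
    binConv (binConv l a) b = binConv a (binConv l b) := by
  apply egf_injective
  simp only [egf_binConv]
  ring

lemma binConv_congr {a a' b b' : ℕ → ℝ} {k : ℕ} (ha : ∀ j ≤ k, a j = a' j)
    (hb : ∀ j ≤ k, b j = b' j) : binConv a b k = binConv a' b' k :=
  Finset.sum_congr rfl fun j hj => by
    rw [ha j (Nat.lt_succ_iff.1 (Finset.mem_range.1 hj)), hb (k - j) (Nat.sub_le k j)]

lemma binConv_update (l a : ℕ → ℝ) (k : ℕ) (c : ℝ) :
    binConv (Function.update l k c) a k
      = ∑ j ∈ Finset.range k, (k.choose j : ℝ) * l j * a (k - j) + c * a 0 := by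
  rw [binConv, Finset.sum_range_succ, Nat.choose_self, Nat.sub_self, Function.update_self,
    Nat.cast_one, one_mul]
  congr 1
  exact Finset.sum_congr rfl fun j hj => by
    rw [Function.update_of_ne (Finset.mem_range.1 hj).ne]

lemma binConv_comm (a b : ℕ → ℝ) : binConv a b = binConv b a := by
  apply egf_injective
  rw [egf_binConv, egf_binConv, mul_comm]

lemma binConv_succ (a b : ℕ → ℝ) (m : ℕ) :
    binConv a b (m + 1) = ∑ j ∈ Finset.range m,
      ((m + 1).choose (j + 1) : ℝ) * a (j + 1) * b (m - j) + a 0 * b (m + 1)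
        + a (m + 1) * b 0 := by
  rw [binConv, Finset.sum_range_succ, Finset.sum_range_succ']
  simp

namespace IsMomentSequence
variable {α : ℝ} {n k m : ℕ} {φ : ℕ → ℝ → ℝ} {x y : ℝ}

lemma apply_zero (h : IsMomentSequence α n φ) : ∀ k, 1 ≤ k → k ≤ n → φ k 0 = 0 := by
  intro k
  induction k using Nat.strong_induction_on with
  | _ k ih =>
    intro h1 hn
    obtain ⟨m, rfl⟩ := Nat.exists_eq_add_of_le' h1
    have e := h.2.2 _ h1 hn 0 0 le_rfl le_rfl
    have e' := binConv_succ (φ · 0) (φ · 0) m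
    rw [binConv, ← e, transl, if_pos rfl, h.1,
      Finset.sum_eq_zero fun j hj => by
        have := Finset.mem_range.1 hj
        rw [ih (j + 1) (by omega) (by omega) (by omega), mul_zero, zero_mul]] at e'
    linarith

lemma translPos_eq_binConv (h : IsMomentSequence α n φ) (hk : 1 ≤ k) (hn : k ≤ n) (hx : 0 < x)
    (hy : 0 < y) : translPos α (φ k) y x = binConv (φ · x) (φ · y) k := by
  have := h.2.2 k hk hn x y hx.le hy.le
  rwa [transl, if_neg hx.ne', if_neg hy.ne'] at this

lemma apply_eq (h : IsMomentSequence α n φ) (hn : m + 1 ≤ n) (hx : 0 < x) (hy : 0 < y) :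
    φ (m + 1) x = translPos α (φ (m + 1)) y x - φ (m + 1) y - ∑ j ∈ Finset.range m,
      ((m + 1).choose (j + 1) : ℝ) * φ (j + 1) x * φ (m - j) y := by
  rw [h.translPos_eq_binConv (Nat.le_add_left _ _) hn hx hy, binConv_succ, h.1, h.1]
  ring

lemma c2At (hα : α < 1 / 2) (h : IsMomentSequence α n φ) :
    ∀ k ≤ n, ∀ x, 0 < x → C2At (φ k) x := by
  intro k
  induction k using Nat.strong_induction_on with
  | _ k ih =>
    intro hn x hx
    obtain _ | m := k
    · rw [show φ 0 = fun _ => 1 from funext h.1]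
      exact (hasLop_const α x 1).1
    · have hy : 0 < x + 1 := by linarith
      have hF := (c2At_translPos hα (h.2.1 (m + 1) (Nat.le_add_left _ _) hn) hx hy
        (by linarith)).hasLop α
      have hS := hasLop_sum (Finset.range m)
        (fun j t => -((m + 1).choose (j + 1) : ℝ) * φ (m - j) (x + 1) * φ (j + 1) t) _
        fun j hj => ((ih (j + 1) (by have := Finset.mem_range.1 hj; omega)
          (by have := Finset.mem_range.1 hj; omega) x hx).hasLop α).const_mul _
      refine (((hF.add (hasLop_const α x (-φ (m + 1) (x + 1)))).add hS).congr ?_).1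
      filter_upwards [lt_mem_nhds hx] with t ht
      rw [h.apply_eq hn ht hy, sub_eq_add_neg, sub_eq_add_neg, ← Finset.sum_neg_distrib]
      congr 1
      exact Finset.sum_congr rfl fun j _ => by ring

lemma tendsto_zero (hα : α < 1 / 2) (h : IsMomentSequence α n φ) :
    ∀ k, 1 ≤ k → k ≤ n → Tendsto (φ k) (𝓝[>] 0) (𝓝 0) := by
  intro k
  induction k using Nat.strong_induction_on with
  | _ k ih =>
    intro h1 hn
    obtain ⟨m, rfl⟩ := Nat.exists_eq_add_of_le' h1
    have hT := tendsto_translPos hα (h.2.1 _ h1 hn) one_pos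
      (h.c2At hα _ hn 1 one_pos).continuousAt
    have hS : Tendsto (fun y => ∑ j ∈ Finset.range m,
        ((m + 1).choose (j + 1) : ℝ) * φ (j + 1) 1 * φ (m - j) y) (𝓝[>] 0)
        (𝓝 (∑ j ∈ Finset.range m, ((m + 1).choose (j + 1) : ℝ) * φ (j + 1) 1 * 0)) :=
      tendsto_finsetSum _ fun j hj => (ih (m - j) (by omega)
        (by have := Finset.mem_range.1 hj; omega) (by omega)).const_mul _
    have := (hT.sub_const (φ (m + 1) 1)).sub hS
    simp only [mul_zero, Finset.sum_const_zero, sub_self] at this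
    refine this.congr' ?_
    filter_upwards [self_mem_nhdsWithin] with y hy
    rw [h.apply_eq hn one_pos hy]
    ring

lemma binConv_Lop_comm (hα : α < 1 / 2) (h : IsMomentSequence α n φ) (hk : 1 ≤ k) (hn : k ≤ n)
    (hx : 0 < x) (hy : 0 < y) (hne : x ≠ y) :
    binConv (fun j => Lop α (φ j) x) (φ · y) k = binConv (φ · x) (fun j => Lop α (φ j) y) k := by
  have hL := Lop_translPos_comm hα (h.2.1 k hk hn) hx hy hne
  have h1 : HasLop α (fun t => translPos α (φ k) y t) x
      (binConv (fun j => Lop α (φ j) x) (φ · y) k) := by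
    refine HasLop.congr (f := fun t => binConv (φ · t) (φ · y) k) ?_ ?_
    · have := hasLop_sum (α := α) (x := x) (Finset.range (k + 1))
        (fun j t => ((k.choose j : ℝ) * φ (k - j) y) * φ j t)
        (fun j => ((k.choose j : ℝ) * φ (k - j) y) * Lop α (φ j) x)
        fun j hj => ((h.c2At hα j (by have := Finset.mem_range.1 hj; omega) x hx).hasLop
          α).const_mul _
      simpa only [binConv, mul_right_comm] using this
    · filter_upwards [lt_mem_nhds hx] with t ht using h.translPos_eq_binConv hk hn ht hy
  have h2 : HasLop α (fun t => translPos α (φ k) t x) y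
      (binConv (φ · x) (fun j => Lop α (φ j) y) k) := by
    refine HasLop.congr (f := fun t => binConv (φ · x) (φ · t) k) ?_ ?_
    · exact hasLop_sum (α := α) (x := y) (Finset.range (k + 1))
        (fun j t => ((k.choose j : ℝ) * φ j x) * φ (k - j) t)
        (fun j => ((k.choose j : ℝ) * φ j x) * Lop α (φ (k - j)) y)
        fun j hj => ((h.c2At hα (k - j) (by omega) y hy).hasLop α).const_mul _
    · filter_upwards [lt_mem_nhds hy] with t ht using h.translPos_eq_binConv hk hn hx ht
  rw [← h1.2, ← h2.2, hL]

lemma exists_ode (hα : α < 1 / 2) (h : IsMomentSequence α n φ) :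
    ∀ K ≤ n, ∃ lam : ℕ → ℝ, lam 0 = 0 ∧ ∀ k ≤ K, ∀ x, 0 < x →
      Lop α (φ k) x = binConv lam (φ · x) k := by
  intro K
  induction K with
  | zero =>
    refine fun _ => ⟨0, rfl, fun k hk x hx => ?_⟩
    obtain rfl : k = 0 := by omega
    rw [show φ 0 = fun _ => 1 from funext h.1, (hasLop_const α x 1).2]
    simp [binConv]
  | succ m ih =>
    intro hn
    obtain ⟨lam, hl0, hl⟩ := ih (by omega)
    set S : ℝ → ℝ := fun x =>
      ∑ j ∈ Finset.range (m + 1), ((m + 1).choose j : ℝ) * lam j * φ (m + 1 - j) x with hS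
    set R : ℝ → ℝ := fun x => Lop α (φ (m + 1)) x - S x with hR
    set l0 := Function.update lam (m + 1) 0 with hl0'
    have hseq : ∀ x, 0 < x → ∀ j ≤ m + 1, Lop α (φ j) x
        = Function.update (binConv l0 (φ · x)) (m + 1) (binConv l0 (φ · x) (m + 1) + R x) j := by
      intro x hx j hj
      rcases eq_or_lt_of_le hj with rfl | hj
      · rw [Function.update_self, hl0', binConv_update, hR]
        simp only [hS]
        ring
      · rw [Function.update_of_ne hj.ne, hl j (by omega) x hx]
        refine binConv_congr (fun i hi => ?_) fun _ _ => rfl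
        rw [hl0', Function.update_of_ne (by omega)]
    have hup : ∀ a b : ℕ → ℝ, ∀ c, binConv (Function.update a (m + 1) (a (m + 1) + c)) b (m + 1)
        = binConv a b (m + 1) + c * b 0 := by
      intro a b c
      have := binConv_update a b (m + 1) (a (m + 1))
      rw [Function.update_eq_self] at this
      rw [binConv_update, this]
      ring
    have hconst : ∀ x y, 0 < x → 0 < y → x ≠ y → R x = R y := by
      intro x y hx hy hne
      have e := h.binConv_Lop_comm hα (Nat.le_add_left 1 m) hn hx hy hne
      rw [binConv_congr (hseq x hx) fun _ _ => rfl, binConv_congr (fun _ _ => rfl) (hseq y hy),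
        hup, binConv_comm (φ · x), hup, binConv_left_comm, binConv_comm (φ · x)] at e
      simp only [h.1] at e
      linarith
    refine ⟨Function.update lam (m + 1) (R 1), ?_, fun k hk x hx => ?_⟩
    · rw [Function.update_of_ne (by omega), hl0]
    · rcases eq_or_lt_of_le hk with rfl | hk
      · have e : R 1 = R x := by
          rcases eq_or_ne 1 x with h1 | h1
          · rw [h1]
          · exact hconst 1 x one_pos hx h1
        rw [binConv_update, e, h.1, hR]
        simp only [hS]
        ring
      · rw [hl k (by omega) x hx]
        refine binConv_congr (fun i hi => ?_) fun _ _ => rfl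
        rw [Function.update_of_ne (by omega)]

end IsMomentSequence

section
variable {α x₁ G : ℝ} {f f' f'' : ℝ → ℝ}

/-- The scale density `x^{3-4α} e^{-1/(2x²)}` of `L`. -/
def scaleP (α x : ℝ) : ℝ := x ^ (3 - 4 * α) * Real.exp (-1 / (2 * x ^ 2))

lemma scaleP_pos {x : ℝ} (hx : 0 < x) : 0 < scaleP α x := by
  unfold scaleP; positivity

lemma hasDerivAt_scaleP {x : ℝ} (hx : 0 < x) :
    HasDerivAt (scaleP α) (scaleP α x / x ^ 2 * (x⁻¹ + (3 - 4 * α) * x)) x := by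
  have h1 := Real.hasDerivAt_rpow_const (x := x) (p := 3 - 4 * α) (Or.inl hx.ne')
  have h2 : HasDerivAt (fun x : ℝ => -1 / (2 * x ^ 2)) (1 / x ^ 3) x := by
    refine ((hasDerivAt_const x (-1 : ℝ)).div ((hasDerivAt_pow 2 x).const_mul 2)
      (by positivity)).congr_deriv ?_
    push_cast
    field_simp
    norm_num
  refine (h1.mul h2.exp).congr_deriv ?_
  rw [scaleP, Real.rpow_sub_one hx.ne']
  field_simp
  ring

lemma scaleP_le (hα : α < 1 / 2) {x : ℝ} (hx : 0 < x) (hx1 : x ≤ 1) : scaleP α x ≤ 2 * x ^ 2 := by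
  have h1 : x ^ (3 - 4 * α) ≤ 1 := Real.rpow_le_one hx.le hx1 (by linarith)
  have h2 : Real.exp (-1 / (2 * x ^ 2)) ≤ 2 * x ^ 2 := by
    rw [neg_div, Real.exp_neg, inv_le_comm₀ (Real.exp_pos _) (by positivity), inv_eq_one_div]
    linarith [Real.add_one_le_exp (1 / (2 * x ^ 2))]
  calc _ ≤ 1 * (2 * x ^ 2) := by unfold scaleP; gcongr
    _ = _ := one_mul _

lemma deriv_le_of_abs_ode_le (hα : α < 1 / 2) (hx₁ : x₁ ≤ 1) (hG : 0 ≤ G)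
    (hf : ∀ x ∈ Ioo 0 x₁, HasDerivAt f (f' x) x)
    (hf' : ∀ x ∈ Ioo 0 x₁, HasDerivAt f' (f'' x) x)
    (hL : ∀ x ∈ Ioo 0 x₁, |x ^ 2 * f'' x + (x⁻¹ + (3 - 4 * α) * x) * f' x| ≤ G)
    (h0 : Tendsto f (𝓝[>] 0) (𝓝 0)) {x : ℝ} (hx : x ∈ Ioo 0 x₁) : f' x ≤ G * x := by
  by_contra! hlt
  have hp := scaleP_pos (α := α) hx.1
  have hsub : Ioc 0 x ⊆ Ioo 0 x₁ := fun t ht => ⟨ht.1, ht.2.trans_lt hx.2⟩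
  have hanti : AntitoneOn (fun t => scaleP α t * (f' t - G * t)) (Ioc 0 x) := by
    have hd : ∀ t ∈ Ioc 0 x, HasDerivAt (fun t => scaleP α t * (f' t - G * t))
        (scaleP α t / t ^ 2 * (t⁻¹ + (3 - 4 * α) * t) * (f' t - G * t)
          + scaleP α t * (f'' t - G)) t := fun t ht =>
      ((hasDerivAt_scaleP ht.1).mul ((hf' t (hsub ht)).sub
        ((hasDerivAt_id t).const_mul G))).congr_deriv (by simp)
    refine antitoneOn_of_hasDerivWithinAt_nonpos (convex_Ioc 0 x)
      (fun t ht => (hd t ht).continuousAt.continuousWithinAt)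
      (fun t ht => (hd t (interior_subset ht)).hasDerivWithinAt) fun t ht => ?_
    have ht' := interior_subset ht
    have ht0 : 0 < t := ht'.1
    have hpt := scaleP_pos (α := α) ht0
    have hb := (abs_le.1 (hL t (hsub ht'))).2
    have e : scaleP α t / t ^ 2 * (t⁻¹ + (3 - 4 * α) * t) * (f' t - G * t)
          + scaleP α t * (f'' t - G)
        = scaleP α t / t ^ 2 * ((t ^ 2 * f'' t + (t⁻¹ + (3 - 4 * α) * t) * f' t)
          - G - G * (4 - 4 * α) * t ^ 2) := by
      field_simp
      ring
    rw [e]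
    refine mul_nonpos_of_nonneg_of_nonpos (by positivity) ?_
    have : 0 ≤ G * (4 - 4 * α) * t ^ 2 :=
      mul_nonneg (mul_nonneg hG (by linarith)) (sq_nonneg t)
    linarith
  set c := scaleP α x * (f' x - G * x) / 2 with hc
  have hc0 : 0 < c := half_pos (mul_pos hp (by linarith))
  have hmono : MonotoneOn (fun t => f t + c * t⁻¹) (Ioc 0 x) := by
    have hd : ∀ t ∈ Ioc 0 x, HasDerivAt (fun t => f t + c * t⁻¹)
        (f' t + c * (-(t ^ 2)⁻¹)) t := fun t ht =>
      (hf t (hsub ht)).add ((hasDerivAt_inv ht.1.ne').const_mul c)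
    refine monotoneOn_of_hasDerivWithinAt_nonneg (convex_Ioc 0 x)
      (fun t ht => (hd t ht).continuousAt.continuousWithinAt)
      (fun t ht => (hd t (interior_subset ht)).hasDerivWithinAt) fun t ht => ?_
    have ht' := interior_subset ht
    have ht0 : 0 < t := ht'.1
    have h1 := hanti ht' (right_mem_Ioc.2 hx.1) ht'.2
    have h2 := scaleP_le hα ht0 (ht'.2.trans (hx.2.le.trans hx₁))
    have h3 : 0 < f' t - G * t := by
      by_contra! h4
      have := mul_nonpos_of_nonneg_of_nonpos (scaleP_pos (α := α) ht0).le h4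
      simp only at h1
      linarith
    have h4 : c ≤ t ^ 2 * f' t := by
      have h5 := mul_le_mul_of_nonneg_right h2 h3.le
      have h6 : 0 ≤ t ^ 2 * (G * t) := by positivity
      simp only at h1
      nlinarith
    have h5 : c * (t ^ 2)⁻¹ ≤ f' t := by
      rw [← div_eq_mul_inv, div_le_iff₀ (by positivity)]
      linarith
    linarith
  have hlim : Tendsto (fun t => f t + c * t⁻¹) (𝓝[>] 0) atTop :=
    h0.add_atTop (tendsto_inv_nhdsGT_zero.const_mul_atTop hc0)
  obtain ⟨t, ht, htx⟩ := ((hlim.eventually_gt_atTop (f x + c * x⁻¹)).and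
    (Ioc_mem_nhdsGT hx.1)).exists
  exact absurd (hmono htx (right_mem_Ioc.2 hx.1) htx.2) (not_le.2 ht)

lemma hasDerivWithinAt_zero_of_abs_ode_le (hα : α < 1 / 2) (hx₀ : 0 < x₁) (hx₁ : x₁ ≤ 1)
    (hG : 0 ≤ G) (hf : ∀ x ∈ Ioo 0 x₁, HasDerivAt f (f' x) x)
    (hf' : ∀ x ∈ Ioo 0 x₁, HasDerivAt f' (f'' x) x)
    (hL : ∀ x ∈ Ioo 0 x₁, |x ^ 2 * f'' x + (x⁻¹ + (3 - 4 * α) * x) * f' x| ≤ G)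
    (h0 : Tendsto f (𝓝[>] 0) (𝓝 0)) (hf0 : f 0 = 0) : HasDerivWithinAt f 0 (Ici 0) 0 := by
  have hb : ∀ x ∈ Ioo 0 x₁, |f' x| ≤ G * x := fun x hx => by
    refine abs_le'.2 ⟨deriv_le_of_abs_ode_le hα hx₁ hG hf hf' hL h0 hx, ?_⟩
    refine deriv_le_of_abs_ode_le (f := fun t => -f t) (f' := fun t => -f' t)
      (f'' := fun t => -f'' t) hα hx₁ hG (fun t ht => (hf t ht).neg) (fun t ht => (hf' t ht).neg)
      (fun t ht => ?_) (by simpa using h0.neg) hx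
    rw [← abs_neg]
    refine (le_of_eq ?_).trans (hL t ht)
    congr 1
    ring
  have hsq : ∀ x ∈ Ioo 0 x₁, |f x| ≤ G * x * x := fun x hx => by
    have h1 : Tendsto (fun s => |f x - f s|) (𝓝[>] 0) (𝓝 |f x - 0|) :=
      (tendsto_const_nhds.sub h0).abs
    rw [sub_zero] at h1
    refine le_of_tendsto h1 ?_
    filter_upwards [Ioo_mem_nhdsGT hx.1] with s hs
    have hsub : Icc s x ⊆ Ioo 0 x₁ := fun t ht => ⟨hs.1.trans_le ht.1, ht.2.trans_lt hx.2⟩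
    have := (convex_Icc s x).norm_image_sub_le_of_norm_hasDerivWithin_le (C := G * x)
      (fun t ht => (hf t (hsub ht)).hasDerivWithinAt)
      (fun t ht => (hb t (hsub ht)).trans (by gcongr; exact ht.2))
      (left_mem_Icc.2 hs.2.le) (right_mem_Icc.2 hs.2.le)
    rw [Real.norm_eq_abs, Real.norm_eq_abs, abs_of_pos (sub_pos.2 hs.2)] at this
    refine this.trans ?_
    have := hx.1.le
    gcongr
    linarith [hs.1]
  refine hasDerivWithinAt_Ioi_iff_Ici.1
    ((hasDerivWithinAt_iff_tendsto_slope' self_notMem_Ioi).2 ?_)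
  have hlim : Tendsto (fun x : ℝ => G * x) (𝓝[>] 0) (𝓝 0) := by
    have : Continuous fun x : ℝ => G * x := by fun_prop
    simpa using (this.tendsto 0).mono_left nhdsWithin_le_nhds
  refine squeeze_zero_norm' ?_ hlim
  filter_upwards [Ioo_mem_nhdsGT hx₀] with x hx
  rw [slope_def_field, hf0, sub_zero, sub_zero, Real.norm_eq_abs, abs_div, abs_of_pos hx.1,
    div_le_iff₀ hx.1]
  exact hsq x hx

end

lemma IsMomentSequence.hasDerivWithinAt_zero {α : ℝ} {n k : ℕ} {φ : ℕ → ℝ → ℝ} (hα : α < 1 / 2)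
    (h : IsMomentSequence α n φ) (hk : 1 ≤ k) (hn : k ≤ n) {lam : ℕ → ℝ}
    (hode : ∀ x, 0 < x → Lop α (φ k) x = binConv lam (φ · x) k) :
    HasDerivWithinAt (φ k) 0 (Ici 0) 0 := by
  have hlim : ∀ j ≤ n, ∃ c, Tendsto (φ j) (𝓝[>] 0) (𝓝 c) := fun j hj => by
    rcases Nat.eq_zero_or_pos j with rfl | h1
    · exact ⟨1, by rw [show φ 0 = fun _ => 1 from funext h.1]; exact tendsto_const_nhds⟩
    · exact ⟨0, h.tendsto_zero hα j h1 hj⟩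
  choose! c hc using hlim
  have hB : Tendsto (fun x => binConv lam (φ · x) k) (𝓝[>] 0) (𝓝 (binConv lam c k)) :=
    tendsto_finsetSum _ fun j _ => (hc (k - j) (by omega)).const_mul _
  set G := |binConv lam c k| + 1 with hG
  obtain ⟨x₁, hx₁, hsub⟩ := mem_nhdsGT_iff_exists_Ioo_subset.1
    ((hB.abs.eventually (gt_mem_nhds (lt_add_one _))))
  have hpos : ∀ x ∈ Ioo 0 (min x₁ 1), 0 < x := fun x hx => hx.1
  refine hasDerivWithinAt_zero_of_abs_ode_le (f' := deriv (φ k)) (f'' := deriv (deriv (φ k)))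
    (x₁ := min x₁ 1) (G := 4 * G) hα (lt_min hx₁ one_pos) (min_le_right _ _) (by positivity)
    (fun x hx => (h.c2At hα k hn x (hpos x hx)).1.self_of_nhds.hasDerivAt)
    (fun x hx => (h.c2At hα k hn x (hpos x hx)).2.hasDerivAt) (fun x hx => ?_)
    (h.tendsto_zero hα k hk hn) (h.apply_zero k hk hn)
  have h1 : |binConv lam (φ · x) k| < G := hsub ⟨hx.1, hx.2.trans_le (min_le_left _ _)⟩
  rw [← hode x hx.1, Lop, abs_mul] at h1
  norm_num at h1
  linarith

/-- Proposition 6.9: if `{φ_k}_{k=1,…,n}` is a `*`-moment sequence, then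
there are reals `λ₁, …, λ_n` with `L φ_k = ∑_{j=1}^k C(k,j) λ_j φ_{k−j}` on `(0,∞)`,
`φ_k(0) = 0` and `φ_k′(0) = 0` (right derivative at `0`). -/
theorem momentSequence_ode (α : ℝ) (hα : α < 1 / 2) (n : ℕ) (φ : ℕ → ℝ → ℝ)
    (hφ : IsMomentSequence α n φ) :
    ∃ lam : ℕ → ℝ, ∀ k, 1 ≤ k → k ≤ n →
      (∀ x : ℝ, 0 < x →
        Lop α (φ k) x = ∑ j ∈ Finset.Icc 1 k, (k.choose j : ℝ) * lam j * φ (k - j) x) ∧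
      φ k 0 = 0 ∧ HasDerivWithinAt (φ k) 0 (Ici 0) 0 := by
  obtain ⟨lam, hl0, hl⟩ := hφ.exists_ode hα n le_rfl
  refine ⟨lam, fun k hk hn => ⟨fun x hx => ?_, hφ.apply_zero k hk hn,
    hφ.hasDerivWithinAt_zero hα hk hn (hl k hn)⟩⟩
  rw [hl k hn x hx, binConv]
  refine (Finset.sum_subset (fun j hj => ?_) fun j hj hj' => ?_).symm
  · rw [Finset.mem_Icc] at hj
    exact Finset.mem_range.2 (by omega)
  · rw [Finset.mem_range] at hj
    rw [Finset.mem_Icc] at hj'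
    obtain rfl : j = 0 := by omega
    rw [hl0, mul_zero, zero_mul]

end
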